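/- arXiv:math/0611397 — 2 statements merged into one kernel-verified Lean document; each statement's English description precedes it below -/
import Mathlib

section
/- Let K be a compact metric space of finite dimension and let f : K → K be a minimal homeomorphism. Then the set of continuous maps A : K → SL(2,ℝ) such that the cocycle (f,A) is either uniformly hyperbolic or has uniform subexponential growth contains a residual (dense Gδ) subset of C(K, SL(2,ℝ)) with the topology of uniform convergence. -/
open MeasureTheory Filter Topology

instance : TopologicalSpace (Matrix.SpecialLinearGroup (Fin 2) ℝ) :=
  TopologicalSpace.induced (fun M => (M : Matrix (Fin 2) (Fin 2) ℝ)) inferInstance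

/-- Operator norm (w.r.t. the euclidean norm on ℝ²) of a 2×2 real matrix. -/
noncomputable def matOpNorm (M : Matrix (Fin 2) (Fin 2) ℝ) : ℝ :=
  ‖Matrix.toEuclideanCLM (𝕜 := ℝ) M‖

noncomputable def sl2Norm (M : Matrix.SpecialLinearGroup (Fin 2) ℝ) : ℝ :=
  matOpNorm (M : Matrix (Fin 2) (Fin 2) ℝ)

/-- The cocycle iterates: `cocycle f A n x = A(f^{n-1} x) ⋯ A(f x) A(x)`. -/
noncomputable def cocycle {K : Type*} (f : K → K)
    (A : K → Matrix.SpecialLinearGroup (Fin 2) ℝ) :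
    ℕ → K → Matrix.SpecialLinearGroup (Fin 2) ℝ
  | 0, _ => 1
  | (n+1), x => cocycle f A n (f x) * A x

/-- The cocycle `(f,A)` is uniformly hyperbolic. -/
def UnifHyp {K : Type*} (f : K → K) (A : K → Matrix.SpecialLinearGroup (Fin 2) ℝ) : Prop :=
  ∃ ε > (0:ℝ), ∃ N : ℕ, ∀ x : K, ∀ n ≥ N, Real.exp (ε * n) ≤ sl2Norm (cocycle f A n x)

/-- The cocycle `(f,A)` has uniform subexponential growth. -/
def UnifSubexp {K : Type*} (f : K → K) (A : K → Matrix.SpecialLinearGroup (Fin 2) ℝ) : Prop :=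
  ∀ ε > (0:ℝ), ∃ N : ℕ, ∀ x : K, ∀ n ≥ N, sl2Norm (cocycle f A n x) ≤ Real.exp (ε * n)

section Dichotomy

open scoped Matrix.Norms.L2Operator

local notation "SL2" => Matrix.SpecialLinearGroup (Fin 2) ℝ
local notation "M2" => Matrix (Fin 2) (Fin 2) ℝ
local notation "E2" => EuclideanSpace ℝ (Fin 2)

/-! ### Linear algebra in dimension two -/

lemma sl2Norm_eq (M : SL2) : sl2Norm M = ‖(M : M2)‖ := rfl

/-- The action of a matrix on the euclidean plane. -/
noncomputable def act (M : M2) (v : E2) : E2 := Matrix.toEuclideanCLM (𝕜 := ℝ) M v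

lemma act_apply (M : M2) (v : E2) (i : Fin 2) : act M v i = M i 0 * v 0 + M i 1 * v 1 := by
  simp [act, Matrix.ofLp_toEuclideanCLM, Matrix.mulVec, dotProduct, Fin.sum_univ_two]

lemma act_mul (M N : M2) (v : E2) : act (M * N) v = act M (act N v) := by
  simp [act]

lemma act_coe_mul (M N : SL2) (v : E2) : act ((M * N : SL2) : M2) v = act M (act N v) := by
  rw [Matrix.SpecialLinearGroup.coe_mul, act_mul]

lemma act_one (v : E2) : act 1 v = v := by
  simp [act]

lemma act_smul (M : M2) (c : ℝ) (v : E2) : act M (c • v) = c • act M v := by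
  simp [act]

lemma act_add (M : M2) (u v : E2) : act M (u + v) = act M u + act M v := by
  simp [act]

lemma norm_act_le (M : M2) (v : E2) : ‖act M v‖ ≤ ‖M‖ * ‖v‖ :=
  (Matrix.toEuclideanCLM (𝕜 := ℝ) M).le_opNorm v

lemma norm_le_of_act_le {M : M2} {C : ℝ} (hC : 0 ≤ C) (h : ∀ v, ‖act M v‖ ≤ C * ‖v‖) :
    ‖M‖ ≤ C :=
  (Matrix.toEuclideanCLM (𝕜 := ℝ) M).opNorm_le_bound hC h

lemma norm_sq_E2 (v : E2) : ‖v‖ ^ 2 = v 0 ^ 2 + v 1 ^ 2 := by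
  simp [EuclideanSpace.norm_sq_eq, Fin.sum_univ_two]

lemma E2_ext {u v : E2} (h0 : u 0 = v 0) (h1 : u 1 = v 1) : u = v := by
  ext i; fin_cases i <;> assumption

lemma continuous_act : Continuous fun p : M2 × E2 => act p.1 p.2 := by
  have : Continuous fun M : M2 => Matrix.toEuclideanCLM (𝕜 := ℝ) M :=
    LinearMap.continuous_of_finiteDimensional
      (Matrix.toEuclideanCLM (𝕜 := ℝ) (n := Fin 2)).toAlgEquiv.toLinearMap
  exact (this.comp continuous_fst).clm_apply continuous_snd

lemma SL2_det (M : SL2) : M 0 0 * M 1 1 - M 0 1 * M 1 0 = 1 := by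
  have := M.det_coe
  rwa [Matrix.det_fin_two] at this

lemma act_ne_zero (M : SL2) {v : E2} (hv : v ≠ 0) : act M v ≠ 0 := by
  intro h
  apply hv
  have : act ((M⁻¹ : SL2) : M2) (act M v) = v := by
    rw [← act_mul, ← Matrix.SpecialLinearGroup.coe_mul]; simp [act_one]
  rw [← this, h]; simp [act]

lemma E2_ne_zero_of_one_le {v : E2} (h : 1 ≤ v 0 ^ 2 + v 1 ^ 2) : v ≠ 0 := by
  rintro rfl; norm_num at h

lemma exists_unit_act_le (M : SL2) : ∃ w : E2, ‖w‖ = 1 ∧ ‖act M w‖ ≤ 1 := by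
  have hdet := SL2_det M
  suffices ∃ w : E2, w ≠ 0 ∧ ‖act M w‖ ≤ ‖w‖ by
    obtain ⟨w, hw, h⟩ := this
    have hw' : 0 < ‖w‖ := norm_pos_iff.2 hw
    refine ⟨‖w‖⁻¹ • w, by simp [norm_smul, hw'.ne'], ?_⟩
    rw [act_smul, norm_smul, norm_inv, norm_norm, inv_mul_le_iff₀ hw']
    simpa using h
  have key : 1 ≤ M 1 1 ^ 2 + M 1 0 ^ 2 ∨ 1 ≤ M 0 1 ^ 2 + M 0 0 ^ 2 := by
    by_contra! h
    nlinarith [sq_nonneg (M 0 0 * M 1 0 + M 0 1 * M 1 1), sq_nonneg (M 0 0), sq_nonneg (M 0 1),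
      sq_nonneg (M 1 0), sq_nonneg (M 1 1)]
  rcases key with h | h
  · have h0 : 1 ≤ (!₂[M 1 1, -M 1 0] : E2) 0 ^ 2 + (!₂[M 1 1, -M 1 0] : E2) 1 ^ 2 := by
      simpa using h
    refine ⟨!₂[M 1 1, -M 1 0], E2_ne_zero_of_one_le h0, ?_⟩
    rw [← sq_le_sq₀ (norm_nonneg _) (norm_nonneg _), norm_sq_E2, norm_sq_E2, act_apply, act_apply]
    simp
    have : M 0 0 * M 1 1 + -(M 0 1 * M 1 0) = 1 := by linarith
    rw [this]; ring_nf; linarith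
  · have h0 : 1 ≤ (!₂[-M 0 1, M 0 0] : E2) 0 ^ 2 + (!₂[-M 0 1, M 0 0] : E2) 1 ^ 2 := by
      simpa using h
    refine ⟨!₂[-M 0 1, M 0 0], E2_ne_zero_of_one_le h0, ?_⟩
    rw [← sq_le_sq₀ (norm_nonneg _) (norm_nonneg _), norm_sq_E2, norm_sq_E2, act_apply, act_apply]
    simp
    have : -(M 1 0 * M 0 1) + M 1 1 * M 0 0 = 1 := by linarith
    rw [this]; ring_nf; linarith

lemma exists_unit_le_act (M : SL2) : ∃ w : E2, w ≠ 0 ∧ ‖w‖ ≤ ‖act M w‖ := by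
  obtain ⟨w, hw, h⟩ := exists_unit_act_le M⁻¹
  have hw0 : w ≠ 0 := by rintro rfl; simp at hw
  refine ⟨act ((M⁻¹ : SL2) : M2) w, act_ne_zero _ hw0, ?_⟩
  rw [← act_mul, ← Matrix.SpecialLinearGroup.coe_mul]
  simpa [act_one, hw] using h

/-- If `P` sends the direction of `M x₁`, where `M` does not expand the direction orthogonal
to `x₁`, to a direction not expanded by `M'`, then `M' P M` is not larger than the sum of the
sizes of the factors. -/
lemma exists_fold (M M' : SL2) : ∃ u z : E2, u ≠ 0 ∧ z ≠ 0 ∧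
    ∀ P : M2, (∃ c : ℝ, act P u = c • z) →
      ‖(M' : M2) * P * (M : M2)‖ ≤ ‖P‖ * (‖(M : M2)‖ + ‖(M' : M2)‖) := by
  obtain ⟨x, hx, hMx⟩ := exists_unit_act_le M
  obtain ⟨z, hz, hMz⟩ := exists_unit_act_le M'
  have hx2 : x 0 ^ 2 + x 1 ^ 2 = 1 := by rw [← norm_sq_E2, hx]; norm_num
  set y : E2 := !₂[x 1, -x 0] with hy
  have hy0 : y 0 = x 1 := by simp [hy]
  have hy1 : y 1 = -x 0 := by simp [hy]
  have hyn : ‖y‖ = 1 := by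
    have : ‖y‖ ^ 2 = 1 := by rw [norm_sq_E2, hy0, hy1]; linarith
    nlinarith [norm_nonneg y]
  have hyne : y ≠ 0 := by intro h; simp [h] at hyn
  refine ⟨act M y, z, act_ne_zero M hyne, by rintro rfl; simp at hz, ?_⟩
  rintro P ⟨c, hc⟩
  have hcle : ‖act M' (act P (act M y))‖ ≤ ‖P‖ * ‖(M : M2)‖ := by
    have h1 : ‖act M' (act P (act M y))‖ ≤ |c| := by
      rw [hc, act_smul, norm_smul, Real.norm_eq_abs]
      nlinarith [abs_nonneg c]
    have h2 : |c| = ‖act P (act M y)‖ := by rw [hc, norm_smul, hz]; simp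
    calc _ ≤ |c| := h1
      _ ≤ ‖P‖ * ‖act M y‖ := by rw [h2]; exact norm_act_le _ _
      _ ≤ ‖P‖ * ‖(M : M2)‖ := by
        have := norm_act_le M y
        rw [hyn, mul_one] at this
        gcongr
  have hxle : ‖act M' (act P (act M x))‖ ≤ ‖P‖ * ‖(M' : M2)‖ := by
    calc _ ≤ ‖(M' : M2)‖ * ‖act P (act M x)‖ := norm_act_le _ _
      _ ≤ ‖(M' : M2)‖ * (‖P‖ * ‖act M x‖) := by gcongr; exact norm_act_le _ _
      _ ≤ ‖(M' : M2)‖ * (‖P‖ * 1) := by gcongr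
      _ = _ := by ring
  refine norm_le_of_act_le (by positivity) fun v => ?_
  set α := v 0 * x 0 + v 1 * x 1 with hα
  set β := v 0 * x 1 - v 1 * x 0 with hβ
  have hv : v = α • x + β • y := by
    apply E2_ext <;> simp [hy0, hy1, hα, hβ]
    · linear_combination (-(v 0)) * hx2
    · linear_combination (-(v 1)) * hx2
  have hαβ : α ^ 2 + β ^ 2 = ‖v‖ ^ 2 := by
    rw [norm_sq_E2, hα, hβ]; linear_combination (v 0 ^ 2 + v 1 ^ 2) * hx2
  have hα1 : |α| ≤ ‖v‖ := abs_le_of_sq_le_sq (by nlinarith) (norm_nonneg v)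
  have hβ1 : |β| ≤ ‖v‖ := abs_le_of_sq_le_sq (by nlinarith) (norm_nonneg v)
  rw [act_mul, act_mul]
  conv_lhs => rw [hv]
  simp only [act_add, act_smul]
  calc _ ≤ |α| * ‖act M' (act P (act M x))‖ + |β| * ‖act M' (act P (act M y))‖ := by
        refine (norm_add_le _ _).trans ?_
        simp [norm_smul]
    _ ≤ ‖v‖ * (‖P‖ * ‖(M' : M2)‖) + ‖v‖ * (‖P‖ * ‖(M : M2)‖) := by gcongr
    _ = _ := by ring

/-! ### Shears -/

/-- The nilpotent endomorphism `v ↦ det (v, w) • w`. -/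
noncomputable def nilp (w : E2) : M2 :=
  !![w 0 * w 1, -(w 0 * w 0); w 1 * w 1, -(w 0 * w 1)]

/-- The shear `1 + t • nilp w` along the direction `w`. -/
noncomputable def shear (w : E2) (t : ℝ) : SL2 :=
  ⟨1 + t • nilp w, by simp [Matrix.det_fin_two, nilp]; ring⟩

lemma coe_shear (w : E2) (t : ℝ) : (shear w t : M2) = 1 + t • nilp w := rfl

lemma act_nilp (w v : E2) : act (nilp w) v = (v 0 * w 1 - v 1 * w 0) • w := by
  apply E2_ext <;> simp [act_apply, nilp] <;> ring

lemma act_shear (w : E2) (t : ℝ) (v : E2) :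
    act (shear w t) v = v + (t * (v 0 * w 1 - v 1 * w 0)) • w := by
  apply E2_ext <;> simp [act_apply, nilp, coe_shear] <;> ring

lemma norm_nilp_le (w : E2) : ‖nilp w‖ ≤ ‖w‖ ^ 2 := by
  refine norm_le_of_act_le (by positivity) fun v => ?_
  rw [act_nilp, norm_smul, Real.norm_eq_abs]
  have : |v 0 * w 1 - v 1 * w 0| ≤ ‖v‖ * ‖w‖ := by
    apply abs_le_of_sq_le_sq _ (by positivity)
    rw [mul_pow, norm_sq_E2, norm_sq_E2]
    nlinarith [sq_nonneg (v 0 * w 0 + v 1 * w 1)]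
  calc _ ≤ (‖v‖ * ‖w‖) * ‖w‖ := by gcongr
    _ = _ := by ring

lemma norm_shear_sub_one_le (w : E2) (t : ℝ) : ‖(shear w t : M2) - 1‖ ≤ |t| * ‖w‖ ^ 2 := by
  rw [coe_shear, add_sub_cancel_left, norm_smul, Real.norm_eq_abs]
  gcongr
  exact norm_nilp_le w

lemma shear_mul_shear (w : E2) (s t : ℝ) : shear w s * shear w t = shear w (s + t) := by
  apply Subtype.ext
  ext i j
  fin_cases i <;> fin_cases j <;>
    simp [coe_shear, nilp, Matrix.mul_apply, Fin.sum_univ_two] <;> ring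

lemma shear_zero (w : E2) : shear w 0 = 1 := by
  apply Subtype.ext; simp [coe_shear]

lemma mul_shear (M : SL2) (w : E2) (t : ℝ) : M * shear w t = shear (act M w) t * M := by
  have hdet := SL2_det M
  apply Subtype.ext
  ext i j
  fin_cases i <;> fin_cases j <;>
    simp [coe_shear, nilp, Matrix.mul_apply, Fin.sum_univ_two, act_apply]
  · linear_combination (-(t * w 1 * (M 0 0 * w 0 + M 0 1 * w 1))) * hdet
  · linear_combination (t * w 0 * (M 0 0 * w 0 + M 0 1 * w 1)) * hdet
  · linear_combination (-(t * w 1 * (M 1 0 * w 0 + M 1 1 * w 1))) * hdet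
  · linear_combination (t * w 0 * (M 1 0 * w 0 + M 1 1 * w 1)) * hdet

lemma exists_shear_slope {w : E2} (hw : ‖w‖ = 1) {τ : ℝ} (hτ : 0 < τ) {v : E2} (hv : v ≠ 0) :
    ∃ t a σ : ℝ, |t| = τ ∧ a ≠ 0 ∧ |σ| ≤ 1 / τ ∧
      act (shear w t) v = a • (w + σ • (!₂[-w 1, w 0] : E2)) := by
  have hw2 : w 0 ^ 2 + w 1 ^ 2 = 1 := by rw [← norm_sq_E2, hw]; norm_num
  set p := v 0 * w 0 + v 1 * w 1 with hp
  set q := v 1 * w 0 - v 0 * w 1 with hq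
  have hpq : 0 < |p| + τ * |q| := by
    by_contra! h
    have h1 : 0 ≤ τ * |q| := by positivity
    have hp0 : p = 0 := abs_eq_zero.1 (le_antisymm (by linarith) (abs_nonneg p))
    have hq0 : q = 0 := by
      have : τ * |q| = 0 := le_antisymm (by linarith [abs_nonneg p]) h1
      rcases mul_eq_zero.1 this with h | h
      · exact absurd h hτ.ne'
      · exact abs_eq_zero.1 h
    apply hv
    apply E2_ext <;> simp
    · linear_combination (-(v 0)) * hw2 + w 0 * hp0 - w 1 * hq0
    · linear_combination (-(v 1)) * hw2 + w 1 * hp0 + w 0 * hq0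
  obtain ⟨t, ht, hta⟩ : ∃ t : ℝ, |t| = τ ∧ |p - t * q| = |p| + τ * |q| := by
    rcases le_total 0 (p * q) with h | h
    · refine ⟨-τ, by simp [abs_of_pos hτ], ?_⟩
      rw [neg_mul, sub_neg_eq_add, ← abs_of_pos hτ, ← abs_mul, abs_of_pos hτ]
      rw [abs_add_eq_add_abs_iff]
      rcases mul_nonneg_iff.1 h with ⟨h1, h2⟩ | ⟨h1, h2⟩
      · left; exact ⟨h1, by positivity⟩
      · right; exact ⟨h1, by nlinarith⟩
    · refine ⟨τ, abs_of_pos hτ, ?_⟩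
      have e : τ * |q| = |-(τ * q)| := by rw [abs_neg, abs_mul, abs_of_pos hτ]
      rw [e, sub_eq_add_neg, abs_add_eq_add_abs_iff]
      rcases mul_nonpos_iff.1 h with ⟨h1, h2⟩ | ⟨h1, h2⟩
      · left; exact ⟨h1, by nlinarith⟩
      · right; exact ⟨h1, by nlinarith⟩
  have ha : p - t * q ≠ 0 := by
    intro h; rw [h, abs_zero] at hta; linarith
  refine ⟨t, p - t * q, q / (p - t * q), ht, ha, ?_, ?_⟩
  · rw [abs_div, hta, div_le_div_iff₀ hpq hτ]
    nlinarith [abs_nonneg p]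
  · have e : act (shear w t) v = (p - t * q) • w + q • (!₂[-w 1, w 0] : E2) := by
      rw [act_shear]
      apply E2_ext <;> simp
      · linear_combination (-(v 0)) * hw2
      · linear_combination (-(v 1)) * hw2
    rw [e, smul_add, smul_smul, mul_div_cancel₀ _ ha]

lemma exists_shears_act {w : E2} (hw : ‖w‖ = 1) {τ : ℝ} (hτ : 0 < τ) {v v' : E2} (hv : v ≠ 0)
    (hv' : v' ≠ 0) : ∃ t₁ t₂ s : ℝ, |t₁| = τ ∧ |t₂| = τ ∧ |s| ≤ 2 / τ ∧ ∃ c : ℝ,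
      act ((shear w t₂ * shear (!₂[-w 1, w 0] : E2) s * shear w t₁ : SL2) : M2) v = c • v' := by
  have hw2 : w 0 ^ 2 + w 1 ^ 2 = 1 := by rw [← norm_sq_E2, hw]; norm_num
  obtain ⟨t₁, a, σ, ht₁, ha, hσ, h₁⟩ := exists_shear_slope hw hτ hv
  obtain ⟨t₂, b, ρ, ht₂, hb, hρ, h₂⟩ := exists_shear_slope hw hτ hv'
  refine ⟨t₁, -t₂, ρ - σ, ht₁, by rwa [abs_neg], ?_, a / b, ?_⟩
  · calc |ρ - σ| ≤ |ρ| + |σ| := abs_sub _ _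
      _ ≤ 1 / τ + 1 / τ := by gcongr
      _ = 2 / τ := by ring
  · rw [Matrix.SpecialLinearGroup.coe_mul, Matrix.SpecialLinearGroup.coe_mul, act_mul, act_mul, h₁,
      act_smul]
    have e : act (shear (!₂[-w 1, w 0] : E2) (ρ - σ)) (w + σ • (!₂[-w 1, w 0] : E2)) =
        b⁻¹ • act (shear w t₂) v' := by
      rw [h₂, smul_smul, inv_mul_cancel₀ hb, one_smul, act_shear]
      apply E2_ext <;> simp
      · linear_combination (-((ρ - σ) * w 1)) * hw2
      · linear_combination ((ρ - σ) * w 0) * hw2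
    rw [e, act_smul, act_smul, ← act_mul, ← Matrix.SpecialLinearGroup.coe_mul, shear_mul_shear]
    simp [shear_zero, act_one, smul_smul, div_eq_mul_inv]

/-! ### Ordered products -/

/-- The ordered product `g (n - 1) ⋯ g 1 g 0`. -/
noncomputable def iterProd (g : ℕ → SL2) : ℕ → SL2
  | 0 => 1
  | n + 1 => g n * iterProd g n

lemma iterProd_succ (g : ℕ → SL2) (n : ℕ) :
    iterProd g (n + 1) = g n * iterProd g n := rfl

lemma iterProd_add (g : ℕ → SL2) (m n : ℕ) :
    iterProd g (m + n) = iterProd (fun k => g (k + n)) m * iterProd g n := by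
  induction m with
  | zero => simp [iterProd]
  | succ m ih => rw [Nat.add_right_comm, iterProd_succ, ih, iterProd_succ, mul_assoc]

lemma iterProd_congr {g g' : ℕ → SL2} {n : ℕ} (h : ∀ k < n, g k = g' k) :
    iterProd g n = iterProd g' n := by
  induction n with
  | zero => rfl
  | succ n ih =>
    rw [iterProd_succ, iterProd_succ, h n n.lt_succ_self,
      ih fun k hk => h k (hk.trans n.lt_succ_self)]

lemma norm_iterProd_le {g : ℕ → SL2} {C : ℝ} {n : ℕ} (h : ∀ k < n, ‖(g k : M2)‖ ≤ C) :
    ‖(iterProd g n : M2)‖ ≤ C ^ n := by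
  induction n with
  | zero => simp [iterProd]
  | succ n ih =>
    rw [iterProd_succ, Matrix.SpecialLinearGroup.coe_mul, pow_succ']
    have hn := h n n.lt_succ_self
    exact (norm_mul_le _ _).trans (mul_le_mul hn (ih fun k hk => h k (hk.trans n.lt_succ_self))
      (norm_nonneg _) ((norm_nonneg _).trans hn))

lemma iterProd_mul_shear (g : ℕ → SL2) (w : E2) (t : ℝ) (n : ℕ) :
    iterProd (fun k => g k * shear (act (iterProd g k) w) t) n
      = iterProd g n * shear w (n * t) := by
  induction n with
  | zero => simp [iterProd, shear_zero]
  | succ n ih =>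
    rw [iterProd_succ, ih, iterProd_succ, mul_assoc, ← mul_assoc (shear _ _), ← mul_shear, mul_assoc,
      shear_mul_shear, ← mul_assoc]
    congr 2; push_cast; ring

/-- Along a sequence of matrices for which some vector has its largest image at the middle time,
small perturbations can send any direction to any other direction. -/
lemma exists_perturb_act (g : ℕ → SL2) (w : E2) (hw : w ≠ 0) (n : ℕ) {θ : ℝ} (hθ : 0 < θ)
    (hn : 2 / θ ^ 2 ≤ n) (hn0 : 0 < n)
    (hmax : ∀ k ≤ 2 * n, ‖act (iterProd g k) w‖ ≤ ‖act (iterProd g n) w‖)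
    {v v' : E2} (hv : v ≠ 0) (hv' : v' ≠ 0) :
    ∃ E : ℕ → SL2, (∀ k < 2 * n + 1, ‖(E k : M2) - 1‖ ≤ θ) ∧
      ∃ c : ℝ, act (iterProd (fun k => g k * E k) (2 * n + 1)) v = c • v' := by
  have hwn : 0 < ‖act (iterProd g n) w‖ := norm_pos_iff.2 (act_ne_zero _ hw)
  wlog hnorm : ‖act (iterProd g n) w‖ = 1 generalizing w
  · refine this (‖act (iterProd g n) w‖⁻¹ • w) (by simp [hw, hwn.ne']) ?_ ?_ ?_
    · intro k hk
      simp only [act_smul, norm_smul]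
      gcongr
      exact hmax k hk
    · simp only [act_smul, norm_smul, norm_inv, norm_norm]; exact mul_pos (inv_pos.2 hwn) hwn
    · simp only [act_smul, norm_smul, norm_inv, norm_norm]; field_simp
  rw [hnorm] at hmax
  set u := act (iterProd g n) w with hu
  have hnR : (0 : ℝ) < n := by exact_mod_cast hn0
  set h : ℕ → SL2 := fun k => g (k + (n + 1)) with hh
  obtain ⟨t₁, t₂, s, ht₁, ht₂, hs, c, hc⟩ := exists_shears_act hnorm (τ := n * θ) (by positivity)
    (act_ne_zero (iterProd g n) hv) (act_ne_zero (iterProd h n * g n)⁻¹ hv')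
  have hs' : |s| ≤ θ := by
    refine hs.trans ?_
    rw [div_le_iff₀ (by positivity)]
    rw [div_le_iff₀ (by positivity)] at hn
    nlinarith
  refine ⟨fun k => if k < n then shear (act (iterProd g k) w) (t₁ / n) else
    if k = n then shear (!₂[-u 1, u 0] : E2) s else
      shear (act (iterProd g k) w) (t₂ / n), ?_, c, ?_⟩
  · have ht : ∀ t : ℝ, |t| = n * θ → ∀ k ≤ 2 * n,
        ‖(shear (act (iterProd g k) w) (t / n) : M2) - 1‖ ≤ θ := by
      intro t ht k hk
      refine (norm_shear_sub_one_le _ _).trans ?_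
      rw [abs_div, ht, abs_of_pos hnR, mul_div_cancel_left₀ _ hnR.ne']
      have := hmax k hk
      have h2 : ‖act (iterProd g k) w‖ ^ 2 ≤ 1 := by nlinarith [norm_nonneg (act (iterProd g k) w)]
      nlinarith
    intro k hk
    have hk' : k ≤ 2 * n := by omega
    dsimp only
    split_ifs with h1 h2
    · exact ht _ ht₁ k hk'
    · refine (norm_shear_sub_one_le _ _).trans ?_
      have : ‖(!₂[-u 1, u 0] : E2)‖ ^ 2 = 1 := by
        have h3 : u 0 ^ 2 + u 1 ^ 2 = 1 := by rw [← norm_sq_E2, hnorm]; norm_num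
        rw [norm_sq_E2]; simp; linarith
      rw [this, mul_one]; exact hs'
    · exact ht _ ht₂ k hk'
  · rw [show 2 * n + 1 = n + (n + 1) by ring, iterProd_add, iterProd_succ]
    have e1 : iterProd (fun k => g k * (if k < n then shear (act (iterProd g k) w) (t₁ / n) else
        if k = n then shear (!₂[-u 1, u 0] : E2) s else
        shear (act (iterProd g k) w) (t₂ / n))) n = iterProd g n * shear w t₁ := by
      rw [iterProd_congr (g' := fun k => g k * shear (act (iterProd g k) w) (t₁ / n)),
        iterProd_mul_shear, mul_div_cancel₀ _ hnR.ne']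
      intro k hk; simp [hk]
    have e2 : iterProd (fun k => g (k + (n + 1)) * (if k + (n + 1) < n then
        shear (act (iterProd g (k + (n + 1))) w) (t₁ / n) else
        if k + (n + 1) = n then shear (!₂[-u 1, u 0] : E2) s else
        shear (act (iterProd g (k + (n + 1))) w) (t₂ / n))) n
          = iterProd h n * shear (act (iterProd g (n + 1)) w) t₂ := by
      rw [iterProd_congr (g' := fun k => h k *
        shear (act (iterProd h k) (act (iterProd g (n + 1)) w)) (t₂ / n)),
        iterProd_mul_shear, mul_div_cancel₀ _ hnR.ne']
      intro k hk
      have h1 : ¬ (k + (n + 1) < n) := by omega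
      have h2 : ¬ (k + (n + 1) = n) := by omega
      rw [if_neg h1, if_neg h2, iterProd_add, Matrix.SpecialLinearGroup.coe_mul, act_mul]
    rw [e1, e2]
    beta_reduce
    rw [if_neg (lt_irrefl n), if_pos rfl]
    have e3 : act (iterProd g (n + 1)) w = act (g n) u := by
      rw [iterProd_succ, Matrix.SpecialLinearGroup.coe_mul, act_mul]
    have e4 : iterProd h n * shear (act (iterProd g (n + 1)) w) t₂ *
        (g n * shear (!₂[-u 1, u 0] : E2) s * (iterProd g n * shear w t₁)) =
        (iterProd h n * g n) * ((shear u t₂ * shear (!₂[-u 1, u 0] : E2) s * shear u t₁) *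
          iterProd g n) := by
      rw [e3, mul_shear (iterProd g n), ← hu]
      simp only [mul_assoc]
      rw [← mul_assoc (shear (act (g n) u) t₂), ← mul_shear]
      simp only [mul_assoc]
    rw [e4, act_coe_mul, act_coe_mul _ (iterProd g n), hc, act_smul, ← act_coe_mul, mul_inv_cancel]
    simp [act_one]

/-! ### Cocycles: continuity and growth -/

lemma continuous_coe_SL2 : Continuous fun M : SL2 => (M : M2) := continuous_induced_dom

lemma isInducing_coe_SL2 : IsInducing fun M : SL2 => (M : M2) := ⟨rfl⟩

lemma cocycle_eq_iterProd {K : Type*} (f : K → K) (A : K → SL2) (n : ℕ) (x : K) :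
    cocycle f A n x = iterProd (fun k => A (f^[k] x)) n := by
  induction n generalizing x with
  | zero => rfl
  | succ n ih =>
    rw [iterProd_add]
    simp only [cocycle, ih, Function.iterate_add_apply, iterProd, mul_one]
    rfl

lemma cocycle_add {K : Type*} (f : K → K) (A : K → SL2) (m n : ℕ) (x : K) :
    cocycle f A (m + n) x = cocycle f A m (f^[n] x) * cocycle f A n x := by
  simp only [cocycle_eq_iterProd, iterProd_add, Function.iterate_add_apply]

lemma cocycle_succ' {K : Type*} (f : K → K) (A : K → SL2) (n : ℕ) (x : K) :
    cocycle f A (n + 1) x = A (f^[n] x) * cocycle f A n x := by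
  simp only [cocycle_eq_iterProd, iterProd_succ]

variable {K : Type*} [MetricSpace K] [CompactSpace K]

lemma continuous_cocycle (f : K ≃ₜ K) (n : ℕ) :
    Continuous fun p : C(K, SL2) × K => (cocycle f p.1 n p.2 : M2) := by
  induction n with
  | zero => exact continuous_const
  | succ n ih =>
    simp only [cocycle_succ', Matrix.SpecialLinearGroup.coe_mul]
    refine Continuous.mul ?_ ih
    refine continuous_coe_SL2.comp ?_
    exact continuous_fst.eval ((f.continuous.iterate n).comp continuous_snd)

lemma continuous_cocycle_right (f : K ≃ₜ K) (A : C(K, SL2)) (n : ℕ) :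
    Continuous fun x : K => (cocycle f A n x : M2) :=
  (continuous_cocycle f n).comp (Continuous.prodMk_right A)

/-- The cocycles whose growth rate is smaller than `μ`, as witnessed by a finite time. -/
def growthBelow (f : K ≃ₜ K) (μ : ℝ) : Set C(K, SL2) :=
  {A | ∃ n : ℕ, 0 < n ∧ ∀ x, ‖(cocycle f A n x : M2)‖ < Real.exp (μ * n)}

lemma isOpen_growthBelow (f : K ≃ₜ K) (μ : ℝ) : IsOpen (growthBelow f μ) := by
  have : growthBelow f μ = ⋃ n : ℕ, ⋃ _ : 0 < n,
      {A : C(K, SL2) | ∀ x, ‖(cocycle f A n x : M2)‖ < Real.exp (μ * n)} := by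
    ext A; simp [growthBelow]
  rw [this]
  refine isOpen_iUnion fun n => isOpen_iUnion fun _ => ?_
  let F : C(K, SL2) → C(K, ℝ) := fun A =>
    ⟨fun x => ‖(cocycle f A n x : M2)‖, (continuous_cocycle_right f A n).norm⟩
  have hF : Continuous F :=
    ContinuousMap.continuous_of_continuous_uncurry _ (continuous_cocycle f n).norm
  have ho : IsOpen {g : C(K, ℝ) | Set.MapsTo g Set.univ (Set.Iio (Real.exp (μ * n)))} :=
    ContinuousMap.isOpen_setOfPred_mapsTo isCompact_univ isOpen_Iio
  convert ho.preimage hF using 1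
  ext A
  simp [Set.MapsTo, F]

lemma exists_norm_bound (A : C(K, SL2)) :
    ∃ C : ℝ, 1 ≤ C ∧ ∀ x, ‖(A x : M2)‖ ≤ C ∧ ‖(((A x)⁻¹ : SL2) : M2)‖ ≤ C := by
  have h1 : Continuous fun x => ‖(A x : M2)‖ := (continuous_coe_SL2.comp A.continuous).norm
  have h2 : Continuous fun x => ‖(((A x)⁻¹ : SL2) : M2)‖ := by
    simp only [Matrix.SpecialLinearGroup.coe_inv]
    exact (continuous_coe_SL2.comp A.continuous).matrix_adjugate.norm
  obtain ⟨C₁, hC₁⟩ := (isCompact_range h1).bddAbove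
  obtain ⟨C₂, hC₂⟩ := (isCompact_range h2).bddAbove
  refine ⟨max 1 (max C₁ C₂), le_max_left _ _, fun x => ⟨?_, ?_⟩⟩
  · exact (hC₁ ⟨x, rfl⟩).trans ((le_max_left _ _).trans (le_max_right _ _))
  · exact (hC₂ ⟨x, rfl⟩).trans ((le_max_right _ _).trans (le_max_right _ _))

lemma norm_cocycle_le_pow (f : K ≃ₜ K) {A : C(K, SL2)} {C : ℝ} (hC : ∀ x, ‖(A x : M2)‖ ≤ C)
    (n : ℕ) (x : K) : ‖(cocycle f A n x : M2)‖ ≤ C ^ n := by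
  rw [cocycle_eq_iterProd]
  exact norm_iterProd_le fun k _ => hC _

lemma exists_bound_of_growthBelow (f : K ≃ₜ K) {A : C(K, SL2)} {μ : ℝ} (hμ : 0 < μ)
    (hA : A ∈ growthBelow f μ) :
    ∃ C : ℝ, 1 ≤ C ∧ ∀ n x, ‖(cocycle f A n x : M2)‖ ≤ C * Real.exp (μ * n) := by
  obtain ⟨N, hN, h⟩ := hA
  obtain ⟨C, hC1, hC⟩ := exists_norm_bound A
  have hmul : ∀ q : ℕ, ∀ x, ‖(cocycle f A (N * q) x : M2)‖ ≤ Real.exp (μ * (N * q : ℕ)) := by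
    intro q
    induction q with
    | zero => intro x; simp [cocycle]
    | succ q ih =>
      intro x
      rw [show N * (q + 1) = N * q + N by ring, cocycle_add, Matrix.SpecialLinearGroup.coe_mul]
      calc _ ≤ _ := norm_mul_le _ _
        _ ≤ Real.exp (μ * (N * q : ℕ)) * Real.exp (μ * N) := by
          gcongr
          · exact ih _
          · exact (h x).le
        _ = _ := by rw [← Real.exp_add]; push_cast; ring_nf
  refine ⟨C ^ N, one_le_pow₀ hC1, fun n x => ?_⟩
  have hn : n = n % N + N * (n / N) := by rw [Nat.mod_add_div]
  conv_lhs => rw [hn]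
  rw [cocycle_add, Matrix.SpecialLinearGroup.coe_mul]
  calc _ ≤ _ := norm_mul_le _ _
    _ ≤ C ^ N * Real.exp (μ * (N * (n / N) : ℕ)) := by
      gcongr
      · refine (norm_cocycle_le_pow f (fun x => (hC x).1) _ _).trans ?_
        exact pow_le_pow_right₀ hC1 (Nat.mod_lt _ hN).le
      · exact hmul _ _
    _ ≤ C ^ N * Real.exp (μ * n) := by
      gcongr
      exact Nat.mul_div_le n N

lemma exists_const_le_exp (C : ℝ) {ε : ℝ} (hε : 0 < ε) :
    ∃ N : ℕ, ∀ n ≥ N, C ≤ Real.exp (ε * n) := by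
  obtain ⟨N, hN⟩ := exists_nat_ge (C / ε)
  refine ⟨N, fun n hn => ?_⟩
  have h1 : C / ε ≤ n := hN.trans (by exact_mod_cast hn)
  rw [div_le_iff₀ hε] at h1
  linarith [Real.add_one_le_exp (ε * n)]

lemma unifSubexp_of_growthBelow (f : K ≃ₜ K) {A : C(K, SL2)}
    (hA : ∀ μ > 0, A ∈ growthBelow f μ) : UnifSubexp f A := by
  intro ε hε
  obtain ⟨C, hC1, hC⟩ := exists_bound_of_growthBelow f (half_pos hε) (hA _ (half_pos hε))
  obtain ⟨N, hN⟩ := exists_const_le_exp C (half_pos hε)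
  refine ⟨N, fun x n hn => ?_⟩
  rw [sl2Norm_eq]
  calc _ ≤ _ := hC n x
    _ ≤ Real.exp (ε / 2 * n) * Real.exp (ε / 2 * n) := by gcongr; exact hN n hn
    _ = _ := by rw [← Real.exp_add]; ring_nf

lemma growthBelow_mono (f : K ≃ₜ K) {μ ν : ℝ} (h : μ ≤ ν) : growthBelow f μ ⊆ growthBelow f ν := by
  rintro A ⟨n, hn, hx⟩
  refine ⟨n, hn, fun x => (hx x).trans_le ?_⟩
  gcongr

lemma exists_mem_growthBelow (f : K ≃ₜ K) (A : C(K, SL2)) : ∃ μ > 0, A ∈ growthBelow f μ := by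
  obtain ⟨C, hC1, hC⟩ := exists_norm_bound A
  refine ⟨C, by linarith, 1, one_pos, fun x => ?_⟩
  have h1 := norm_cocycle_le_pow f (fun x => (hC x).1) 1 x
  have h2 := Real.add_one_le_exp C
  simp only [pow_one] at h1
  simp only [Nat.cast_one, mul_one]
  linarith

/-! ### Failure of uniform hyperbolicity -/

lemma seq_growth {a : ℕ → ℝ} (ha : ∀ j, 0 < a j) {C ρ : ℝ} (hC : 1 ≤ C) (hρ : 1 < ρ)
    (hup : ∀ j, a (j + 1) ≤ C * a j) (hdown : ∀ j, a j ≤ C * a (j + 1)) {n c : ℕ}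
    (h : ∀ j, ∃ k ≤ 2 * n, ρ ^ n * a (j + n) < a (j + k)) (hc : C ^ n < ρ ^ c)
    (h0 : a 0 ≤ a (c + n)) {L : ℕ} (hL : c + 2 * n ≤ L) :
    ρ ^ (L - (c + 2 * n)) * a 0 ≤ C ^ n * a L := by
  have hρ0 : 0 < ρ := by linarith
  have hup' : ∀ i, a i ≤ C ^ i * a 0 := by
    intro i
    induction i with
    | zero => simp
    | succ i ih => rw [pow_succ', mul_assoc]; exact (hup i).trans (by gcongr)
  have hdown' : ∀ i j, a j ≤ C ^ i * a (j + i) := by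
    intro i j
    induction i with
    | zero => simp
    | succ i ih =>
      calc _ ≤ _ := ih
        _ ≤ C ^ i * (C * a (j + i + 1)) := by gcongr; exact hdown _
        _ = _ := by rw [pow_succ, add_assoc]; ring
  set d : ℕ → ℕ := fun j => max j (c + n) - min j (c + n) with hd
  obtain ⟨j, hj, hmax⟩ := Finset.exists_max_image (Finset.range (L + 1)) (fun j => a j / ρ ^ d j)
    ⟨0, by simp⟩
  have hjL : j ≤ L := by simpa [Nat.lt_succ_iff] using hj
  have hcmax : a (c + n) ≤ a j / ρ ^ d j := by
    have := hmax (c + n) (by simp; omega)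
    simpa [hd] using this
  rcases lt_or_ge j n with hjn | hjn
  · exfalso
    have hdj : c ≤ d j := by simp only [hd]; omega
    have h1 : a j ≤ C ^ n * a 0 :=
      (hup' j).trans (by gcongr; exact (ha 0).le)
    have h2 : a j / ρ ^ d j < a 0 := by
      rw [div_lt_iff₀ (by positivity)]
      have h3 : ρ ^ c ≤ ρ ^ d j := pow_le_pow_right₀ hρ.le hdj
      nlinarith [ha 0]
    linarith
  rcases le_or_gt (j + n) L with hjn2 | hjn2
  · exfalso
    obtain ⟨k, hk, hk'⟩ := h (j - n)
    rw [Nat.sub_add_cancel hjn] at hk'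
    have h1 := hmax (j - n + k) (by simp; omega)
    have hdk : d (j - n + k) ≤ d j + n := by simp only [hd]; omega
    have h2 : ρ ^ d (j - n + k) ≤ ρ ^ d j * ρ ^ n := by
      rw [← pow_add]; exact pow_le_pow_right₀ hρ.le hdk
    have hp1 : 0 < ρ ^ d (j - n + k) := by positivity
    have hp2 : 0 < ρ ^ d j := by positivity
    rw [div_le_div_iff₀ hp1 hp2] at h1
    have h3 : a j * ρ ^ d (j - n + k) ≤ a j * (ρ ^ d j * ρ ^ n) := by
      gcongr; exact (ha j).le
    nlinarith
  · have hdj : L - (c + 2 * n) ≤ d j := by simp only [hd]; omega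
    have h1 := hdown' (L - j) j
    rw [Nat.add_sub_cancel' hjL] at h1
    rw [le_div_iff₀ (by positivity)] at hcmax
    calc ρ ^ (L - (c + 2 * n)) * a 0 ≤ ρ ^ d j * a (c + n) := by
          gcongr
          · exact (ha 0).le
          · exact hρ.le
      _ ≤ a j := by linarith
      _ ≤ C ^ (L - j) * a L := h1
      _ ≤ C ^ n * a L := by
        gcongr
        · exact (ha L).le
        · omega

/-- If the cocycle is not uniformly hyperbolic, then on arbitrarily long orbit segments there are
vectors whose images are largest at the middle time. -/
lemma exists_max_middle (f : K ≃ₜ K) {A : C(K, SL2)} (hA : ¬ UnifHyp f A) {n : ℕ} (hn : 0 < n) :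
    ∃ (x : K) (w : E2), w ≠ 0 ∧
      ∀ k ≤ 2 * n, ‖act (cocycle f A k x) w‖ ≤ ‖act (cocycle f A n x) w‖ := by
  by_contra! hcon
  apply hA
  rcases isEmpty_or_nonempty K with hK | hK
  · exact ⟨1, one_pos, 0, fun x => (hK.false x).elim⟩
  obtain ⟨C, hC1, hC⟩ := exists_norm_bound A
  let S := Metric.sphere (0 : E2) 1
  have hS0 : ∀ w : S, (w : E2) ≠ 0 := fun w => ne_zero_of_mem_unit_sphere w
  have hSne : Nonempty S := by
    obtain ⟨w, hw, -⟩ := exists_unit_act_le 1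
    exact ⟨⟨w, by simpa [S] using hw⟩⟩
  let r : ℕ → K × S → ℝ := fun k p =>
    ‖act (cocycle f A k p.1) p.2‖ / ‖act (cocycle f A n p.1) p.2‖
  have hcont : ∀ k, Continuous fun p : K × S => ‖act (cocycle f A k p.1) (p.2 : E2)‖ := fun k =>
    (continuous_act.comp (((continuous_cocycle_right f A k).comp continuous_fst).prodMk
      (continuous_subtype_val.comp continuous_snd))).norm
  have hr : ∀ k, Continuous (r k) := fun k => (hcont k).div (hcont n) fun p =>
    norm_ne_zero_iff.2 (act_ne_zero _ (hS0 p.2))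
  have hne : (Finset.range (2 * n + 1)).Nonempty := ⟨0, by simp⟩
  let F : K × S → ℝ := fun p => (Finset.range (2 * n + 1)).sup' hne fun k => r k p
  have hF : Continuous F := Continuous.finset_sup'_apply hne fun k _ => hr k
  obtain ⟨p₀, -, hp₀⟩ := isCompact_univ.exists_isMinOn
    (Set.univ_nonempty (α := K × S)) hF.continuousOn
  have hmin : ∀ p, F p₀ ≤ F p := fun p => hp₀ (Set.mem_univ p)
  have hF1 : 1 < F p₀ := by
    obtain ⟨k, hk, hlt⟩ := hcon p₀.1 p₀.2 (hS0 _)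
    refine (Finset.lt_sup'_iff hne).2 ⟨k, by simp; omega, ?_⟩
    exact (one_lt_div (norm_pos_iff.2 (act_ne_zero _ (hS0 p₀.2)))).2 hlt
  set m := (1 + F p₀) / 2 with hm
  have hm1 : 1 < m := by linarith
  set ρ := m ^ ((n : ℝ)⁻¹) with hρdef
  have hρn : ρ ^ n = m := Real.rpow_inv_natCast_pow (by linarith) hn.ne'
  have hρ : 1 < ρ := Real.one_lt_rpow hm1 (by positivity)
  have hgrow : ∀ x (w : E2), w ≠ 0 → ∃ k ≤ 2 * n,
      ρ ^ n * ‖act (cocycle f A n x) w‖ < ‖act (cocycle f A k x) w‖ := by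
    intro x w hw
    have hwpos : 0 < ‖w‖ := norm_pos_iff.2 hw
    let w' : S := ⟨‖w‖⁻¹ • w, by simp [S, norm_smul, hwpos.ne']⟩
    have hlt : m < F (x, w') := lt_of_lt_of_le (by linarith) (hmin (x, w'))
    obtain ⟨k, hk, hk'⟩ := (Finset.lt_sup'_iff hne).1 hlt
    refine ⟨k, by simp at hk; omega, ?_⟩
    have hn' : 0 < ‖act (cocycle f A n x) w‖ := norm_pos_iff.2 (act_ne_zero _ hw)
    simp only [r, w', act_smul, norm_smul, norm_inv, norm_norm] at hk'
    rw [mul_div_mul_left _ _ (inv_pos.2 hwpos).ne', lt_div_iff₀ hn'] at hk'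
    rwa [hρn]
  obtain ⟨c, hc⟩ := pow_unbounded_of_one_lt (C ^ n) hρ
  have hlog : 0 < Real.log ρ := Real.log_pos hρ
  obtain ⟨N, hN⟩ := exists_const_le_exp (ρ ^ (c + 2 * n) * C ^ n) (half_pos hlog)
  refine ⟨Real.log ρ / 2, half_pos hlog, max N (c + 2 * n), fun x L hL => ?_⟩
  have hLN : N ≤ L := (le_max_left _ _).trans hL
  have hLc : c + 2 * n ≤ L := (le_max_right _ _).trans hL
  rw [sl2Norm_eq]
  obtain ⟨w, hw, hwc⟩ := exists_unit_le_act (cocycle f A (c + n) x)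
  have hwpos : 0 < ‖w‖ := norm_pos_iff.2 hw
  have key := seq_growth (a := fun j => ‖act (cocycle f A j x) w‖) (C := C) (ρ := ρ) (n := n)
    (c := c) (fun j => norm_pos_iff.2 (act_ne_zero _ hw)) hC1 hρ ?_ ?_ ?_ hc
    (by simpa [cocycle, act_one] using hwc) hLc
  · simp only [cocycle, Matrix.SpecialLinearGroup.coe_one, act_one] at key
    have h1 : ρ ^ (L - (c + 2 * n)) ≤ C ^ n * ‖(cocycle f A L x : M2)‖ := by
      refine le_of_mul_le_mul_right ?_ hwpos
      rw [mul_assoc]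
      exact key.trans (by gcongr; exact norm_act_le _ _)
    have hexp : Real.exp (Real.log ρ / 2 * L) * Real.exp (Real.log ρ / 2 * L) = ρ ^ L := by
      rw [← Real.exp_add, ← add_mul, add_halves, mul_comm, Real.exp_nat_mul,
        Real.exp_log (by linarith)]
    have hsplit : ρ ^ L = ρ ^ (c + 2 * n) * ρ ^ (L - (c + 2 * n)) := by
      rw [← pow_add, Nat.add_sub_cancel' hLc]
    have h2 := hN L hLN
    have hρpos : 0 < ρ ^ (c + 2 * n) := by positivity
    refine le_of_mul_le_mul_left ?_ (Real.exp_pos (Real.log ρ / 2 * L))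
    rw [hexp, hsplit]
    calc _ ≤ ρ ^ (c + 2 * n) * (C ^ n * ‖(cocycle f A L x : M2)‖) := by gcongr
      _ = ρ ^ (c + 2 * n) * C ^ n * ‖(cocycle f A L x : M2)‖ := by ring
      _ ≤ _ := by gcongr
  · intro j
    simp only [cocycle_succ', act_coe_mul]
    exact (norm_act_le _ _).trans (by gcongr; exact (hC _).1)
  · intro j
    have e : act (cocycle f A j x) w
        = act (((A (f^[j] x))⁻¹ : SL2) : M2) (act (cocycle f A (j + 1) x) w) := by
      rw [cocycle_succ', ← act_coe_mul, inv_mul_cancel_left]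
    rw [e]
    refine (norm_act_le _ _).trans ?_
    gcongr
    exact (hC (f^[j] x)).2
  · intro j
    obtain ⟨k, hk, hlt⟩ := hgrow (f^[j] x) (act (cocycle f A j x) w) (act_ne_zero _ hw)
    refine ⟨k, hk, ?_⟩
    rwa [add_comm j n, add_comm j k, cocycle_add, cocycle_add, act_coe_mul, act_coe_mul]

/-! ### General position of finitely many functions along orbits -/

lemma exists_ball_iterate_ne {f : K ≃ₜ K} (hper : ∀ x, ∀ n : ℕ, 0 < n → f^[n] x ≠ x)
    (x : K) (T : ℕ) : ∃ ε > 0, ∀ j ≤ T, ∀ j' ≤ T, j ≠ j' →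
      ∀ y ∈ Metric.closedBall x ε, ∀ y' ∈ Metric.closedBall x ε, f^[j] y ≠ f^[j'] y' := by
  have hlt : ∀ j j' : ℕ, j < j' → f^[j] x ≠ f^[j'] x := by
    intro j j' h he
    refine hper x (j' - j) (by omega) ?_
    apply f.injective.iterate j
    rw [← Function.iterate_add_apply, Nat.add_sub_cancel' h.le, he]
  have hne : ∀ j j' : ℕ, j ≠ j' → f^[j] x ≠ f^[j'] x := by
    intro j j' h
    rcases lt_or_gt_of_ne h with h | h
    · exact hlt _ _ h
    · exact (hlt _ _ h).symm
  have hev : ∀ᶠ p : K × K in 𝓝 x ×ˢ 𝓝 x, ∀ j ∈ Finset.range (T + 1),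
      ∀ j' ∈ Finset.range (T + 1), j ≠ j' → f^[j] p.1 ≠ f^[j'] p.2 := by
    rw [← nhds_prod_eq]
    simp only [Filter.eventually_all_finset, Filter.eventually_imp_distrib_left]
    intro j _ j' _ h
    have hc : ContinuousAt (fun p : K × K => (f^[j] p.1, f^[j'] p.2)) (x, x) :=
      (((f.continuous.iterate j).comp continuous_fst).prodMk
        ((f.continuous.iterate j').comp continuous_snd)).continuousAt
    have : {p : K × K | p.1 ≠ p.2} ∈ 𝓝 (f^[j] x, f^[j'] x) :=
      (isOpen_ne_fun continuous_fst continuous_snd).mem_nhds (hne j j' h)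
    exact hc this
  obtain ⟨ε, hε, h⟩ := (Metric.nhds_basis_closedBall.prod_self).eventually_iff.1 hev
  refine ⟨ε, hε, fun j hj j' hj' hjj y hy y' hy' => ?_⟩
  exact h (Set.mk_mem_prod hy hy') j (by simp; omega) j' (by simp; omega) hjj

/-- Continuous functions on a compact subset of a euclidean space are uniform limits of restrictions
of continuously differentiable functions. -/
lemma exists_contDiff_near {d : ℕ} {s : K → EuclideanSpace ℝ (Fin d)} (hs : IsEmbedding s)
    (g : C(K, ℝ)) {η : ℝ} (hη : 0 < η) :
    ∃ P : EuclideanSpace ℝ (Fin d) → ℝ, ContDiff ℝ 1 P ∧ ∀ x, |P (s x) - g x| < η := by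
  let 𝒜 : Subalgebra ℝ C(K, ℝ) :=
    { carrier := {g | ∃ P : EuclideanSpace ℝ (Fin d) → ℝ, ContDiff ℝ 1 P ∧ ∀ x, g x = P (s x)}
      mul_mem' := by
        rintro a b ⟨P, hP, ha⟩ ⟨Q, hQ, hb⟩
        exact ⟨fun z => P z * Q z, hP.mul hQ, fun x => by simp [ha, hb]⟩
      add_mem' := by
        rintro a b ⟨P, hP, ha⟩ ⟨Q, hQ, hb⟩
        exact ⟨fun z => P z + Q z, hP.add hQ, fun x => by simp [ha, hb]⟩
      algebraMap_mem' := fun r => ⟨fun _ => r, contDiff_const, fun x => by simp⟩ }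
  have hsep : 𝒜.SeparatesPoints := by
    intro x y hxy
    have : s x ≠ s y := fun h => hxy (hs.injective h)
    obtain ⟨i, hi⟩ : ∃ i, s x i ≠ s y i := by
      by_contra! h
      exact this (by ext i; exact h i)
    refine ⟨fun z => s z i, ⟨⟨fun z => s z i, ?_⟩, ⟨fun v => v i, ?_, fun _ => rfl⟩, rfl⟩, hi⟩
    · have := hs.continuous
      fun_prop
    · fun_prop
  have htop := ContinuousMap.subalgebra_topologicalClosure_eq_top_of_separatesPoints 𝒜 hsep
  have hg : g ∈ closure (𝒜 : Set C(K, ℝ)) := by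
    have : g ∈ 𝒜.topologicalClosure := by rw [htop]; trivial
    exact this
  obtain ⟨b, ⟨P, hP, hb⟩, hdist⟩ := Metric.mem_closure_iff.1 hg η hη
  refine ⟨P, hP, fun x => ?_⟩
  rw [← hb, ← Real.dist_eq, dist_comm]
  exact (ContinuousMap.dist_apply_le_dist x).trans_lt hdist

/-- Finite families of functions such that, over the set `N`, the functions given by the index set
`S` stay jointly away from zero. -/
def awayFromZero (f : K ≃ₜ K) {q : ℕ} (S : Finset (Fin q × ℕ)) (N : Set K) :
    Set (Fin q → C(K, ℝ)) :=
  {ψ | ∃ κ > 0, ∀ x ∈ N, ∃ p ∈ S, κ < |ψ p.1 (f^[p.2] x)|}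

lemma isOpen_awayFromZero (f : K ≃ₜ K) {q : ℕ} (S : Finset (Fin q × ℕ)) (N : Set K) :
    IsOpen (awayFromZero f S N) := by
  rw [Metric.isOpen_iff]
  rintro ψ ⟨κ, hκ, h⟩
  refine ⟨κ / 2, half_pos hκ, fun ψ' hψ' => ⟨κ / 2, half_pos hκ, fun x hx => ?_⟩⟩
  obtain ⟨p, hp, hlt⟩ := h x hx
  refine ⟨p, hp, ?_⟩
  have h1 : dist (ψ' p.1 (f^[p.2] x)) (ψ p.1 (f^[p.2] x)) < κ / 2 :=
    (ContinuousMap.dist_apply_le_dist _).trans_lt ((dist_le_pi_dist ψ' ψ p.1).trans_lt hψ')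
  rw [Real.dist_eq] at h1
  have h2 := abs_sub_abs_le_abs_sub (ψ p.1 (f^[p.2] x)) (ψ' p.1 (f^[p.2] x))
  rw [abs_sub_comm] at h2
  linarith

lemma dense_awayFromZero {f : K ≃ₜ K} {d : ℕ} {s : K → EuclideanSpace ℝ (Fin d)}
    (hs : IsEmbedding s) {q T : ℕ} {S : Finset (Fin q × ℕ)} (hS : d < S.card)
    (hST : ∀ p ∈ S, p.2 ≤ T) {N : Set K} (hN : IsCompact N)
    (hdisj : ∀ j ≤ T, ∀ j' ≤ T, j ≠ j' → ∀ y ∈ N, ∀ y' ∈ N, f^[j] y ≠ f^[j'] y') :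
    Dense (awayFromZero f S N) := by
  rw [Metric.dense_iff]
  intro ψ η hη
  set η' := η / (2 * S.card + 1) with hη'def
  have hη' : 0 < η' := by positivity
  choose P hP hPs using fun p : Fin q × ℕ =>
    exists_contDiff_near hs ((ψ p.1).comp ⟨f^[p.2], f.continuous.iterate p.2⟩) hη'
  let F : EuclideanSpace ℝ (Fin d) → (S → ℝ) := fun v p => P p v
  have hF : ContDiff ℝ 1 F := contDiff_pi.2 fun p => hP p
  have hdense : Dense (Set.range F)ᶜ :=
    hF.dense_compl_range_of_finrank_lt_finrank (by simpa using hS)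
  obtain ⟨c, hcball, hc⟩ := Metric.dense_iff.1 hdense 0 η' hη'
  have hcp : ∀ p, |c p| < η' := fun p => by
    have h1 : ‖c‖ < η' := by simpa using hcball
    exact (norm_le_pi_norm c p).trans_lt h1
  let e : S → C(K, ℝ) := fun p =>
    ⟨fun x => P p (s x) - c p - ψ p.1.1 (f^[p.1.2] x), by
      have h1 := (hP p).continuous
      have h2 := hs.continuous
      have h3 := f.continuous.iterate p.1.2
      exact ((h1.comp h2).sub continuous_const).sub ((ψ p.1.1).continuous.comp h3)⟩
  have he : ∀ p x, |e p x| ≤ 2 * η' := fun p x => by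
    have h1 := hPs p x
    have h2 := hcp p
    simp only [ContinuousMap.comp_apply, ContinuousMap.coe_mk] at h1
    simp only [e, ContinuousMap.coe_mk]
    rw [abs_lt] at h1 h2
    rw [abs_le]
    constructor <;> linarith
  have hχ : ∀ j : ℕ, j ≤ T → ∃ χ : C(K, ℝ), (∀ y ∈ N, χ (f^[j] y) = 1) ∧
      (∀ j' ≤ T, j' ≠ j → ∀ y ∈ N, χ (f^[j'] y) = 0) ∧ ∀ x, χ x ∈ Set.Icc (0 : ℝ) 1 := by
    intro j hj
    have hcl : ∀ j : ℕ, IsClosed (f^[j] '' N) := fun j =>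
      (hN.image (f.continuous.iterate j)).isClosed
    have hcl' : IsClosed (⋃ j' ∈ (Finset.range (T + 1)).erase j, f^[j'] '' N) :=
      isClosed_biUnion_finset fun j' _ => hcl j'
    obtain ⟨χ, h0, h1, h01⟩ := exists_continuous_zero_one_of_isClosed hcl' (hcl j) (by
      rw [Set.disjoint_left]
      rintro _ hy ⟨y, hyN, rfl⟩
      simp only [Set.mem_iUnion] at hy
      obtain ⟨j', hj', y', hy', he⟩ := hy
      simp only [Finset.mem_erase, Finset.mem_range] at hj'
      exact hdisj j' (by omega) j hj hj'.1 y' hy' y hyN he)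
    refine ⟨χ, fun y hy => h1 ⟨y, hy, rfl⟩, fun j' hj' hne y hy => h0 ?_, h01⟩
    simp only [Set.mem_iUnion]
    exact ⟨j', by simp [hne]; omega, y, hy, rfl⟩
  choose! χ hχ1 hχ0 hχI using hχ
  let ψ' : Fin q → C(K, ℝ) := fun i => ψ i + ∑ p : S,
    if p.1.1 = i then χ p.1.2 * (e p).comp ⟨(f.symm)^[p.1.2], f.symm.continuous.iterate _⟩ else 0
  have hψ' : ∀ i x, ψ' i x = ψ i x + ∑ p : S,
      if p.1.1 = i then χ p.1.2 x * e p ((f.symm)^[p.1.2] x) else 0 := by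
    intro i x
    simp only [ψ', ContinuousMap.add_apply, ContinuousMap.sum_apply]
    congr 1
    refine Finset.sum_congr rfl fun p _ => ?_
    split_ifs <;> simp
  have hval : ∀ p : S, ∀ x ∈ N, ψ' p.1.1 (f^[p.1.2] x) = P p (s x) - c p := by
    intro p x hx
    rw [hψ', Finset.sum_eq_single p]
    · have hinv : (f.symm)^[p.1.2] (f^[p.1.2] x) = x := f.left_inv.iterate p.1.2 x
      rw [if_pos rfl, hχ1 _ (hST _ p.2) x hx, hinv]
      simp [e]
    · intro p' _ hne
      split_ifs with h
      · have hj : p.1.2 ≠ p'.1.2 := fun hj => hne (Subtype.ext (Prod.ext h hj.symm))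
        rw [hχ0 _ (hST _ p'.2) _ (hST _ p.2) hj x hx, zero_mul]
      · rfl
    · simp
  refine ⟨ψ', ?_, ?_⟩
  · rw [Metric.mem_ball]
    have hb : dist ψ' ψ ≤ S.card * (2 * η') := by
      refine (dist_pi_le_iff (by positivity)).2 fun i =>
        (ContinuousMap.dist_le (by positivity)).2 fun x => ?_
      rw [hψ', Real.dist_eq, add_sub_cancel_left]
      refine (Finset.abs_sum_le_sum_abs _ _).trans ?_
      refine (Finset.sum_le_card_nsmul _ _ (2 * η') fun p _ => ?_).trans (by simp)
      split_ifs
      · rw [abs_mul]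
        have h1 := hχI _ (hST _ p.2) x
        calc _ ≤ 1 * (2 * η') := by
              gcongr
              · rw [abs_of_nonneg h1.1]; exact h1.2
              · exact he _ _
          _ = _ := one_mul _
      · simp; positivity
    refine hb.trans_lt ?_
    have : η = (2 * S.card + 1) * η' := by rw [hη'def]; field_simp
    nlinarith
  · have hG : Continuous fun x => ∑ p : S, |ψ' p.1.1 (f^[p.1.2] x)| := by
      refine continuous_finsetSum _ fun p _ => ?_
      exact ((ψ' _).continuous.comp (f.continuous.iterate _)).abs
    have hGpos : ∀ x ∈ N, 0 < ∑ p : S, |ψ' p.1.1 (f^[p.1.2] x)| := by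
      intro x hx
      by_contra! h
      apply hc
      refine ⟨s x, funext fun p => ?_⟩
      have h0 := Finset.sum_nonneg fun (p : S) (_ : p ∈ Finset.univ) =>
        abs_nonneg (ψ' p.1.1 (f^[p.1.2] x))
      have := (Finset.sum_eq_zero_iff_of_nonneg fun (p : S) _ =>
        abs_nonneg (ψ' p.1.1 (f^[p.1.2] x))).1 (le_antisymm h h0) p (Finset.mem_univ _)
      rw [hval p x hx, abs_eq_zero] at this
      simp only [F]; linarith
    rcases N.eq_empty_or_nonempty with rfl | hNe
    · exact ⟨1, one_pos, by simp⟩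
    obtain ⟨x₀, hx₀, hmin⟩ := hN.exists_isMinOn hNe hG.continuousOn
    set m := ∑ p : S, |ψ' p.1.1 (f^[p.1.2] x₀)| with hm
    have hm0 : 0 < m := hGpos x₀ hx₀
    refine ⟨m / (S.card + 1), by positivity, fun x hx => ?_⟩
    by_contra! h
    have h1 : m ≤ ∑ p : S, |ψ' p.1.1 (f^[p.1.2] x)| := hmin hx
    have h2 : ∑ p : S, |ψ' p.1.1 (f^[p.1.2] x)| ≤ S.card * (m / (S.card + 1)) := by
      refine (Finset.sum_le_card_nsmul _ _ _ fun p _ => h p.1 p.2).trans (by simp)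
    have h3 : (S.card + 1) * (m / (S.card + 1)) = m := by field_simp
    have h4 : 0 < m / (S.card + 1) := by positivity
    nlinarith

/-- Any finite family of functions can be perturbed so that along each orbit segment of length `T`
the functions come near zero at most `d` times, where `d` is the dimension of a euclidean space
containing `K`. -/
lemma exists_general_position {f : K ≃ₜ K} (hper : ∀ x, ∀ n : ℕ, 0 < n → f^[n] x ≠ x)
    {d : ℕ} {s : K → EuclideanSpace ℝ (Fin d)} (hs : IsEmbedding s) {q : ℕ}
    (φ : Fin q → C(K, ℝ)) (T : ℕ) {η : ℝ} (hη : 0 < η) :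
    ∃ ψ : Fin q → C(K, ℝ), (∀ i x, |ψ i x - φ i x| < η) ∧ ∃ κ > 0, ∀ x,
      ∀ S : Finset (Fin q × ℕ), (∀ p ∈ S, p.2 ≤ T ∧ |ψ p.1 (f^[p.2] x)| ≤ κ) → S.card ≤ d := by
  choose ε hε hball using fun x => exists_ball_iterate_ne hper x T
  obtain ⟨t, -, ht⟩ := isCompact_univ.elim_nhds_subcover (fun x => Metric.closedBall x (ε x))
    fun x _ => Metric.closedBall_mem_nhds x (hε x)
  let I : Finset (Finset (Fin q × ℕ) × K) :=
    (Finset.powersetCard (d + 1) (Finset.univ ×ˢ Finset.range (T + 1))) ×ˢ t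
  have hI : ∀ a ∈ I, a.1.card = d + 1 ∧ ∀ p ∈ a.1, p.2 ≤ T := by
    intro a ha
    obtain ⟨h1, -⟩ := Finset.mem_product.1 ha
    obtain ⟨h1, h2⟩ := Finset.mem_powersetCard.1 h1
    refine ⟨h2, fun p hp => ?_⟩
    have := h1 hp
    simp at this
    omega
  have hd : Dense (⋂ a ∈ (I : Set (Finset (Fin q × ℕ) × K)),
      awayFromZero f a.1 (Metric.closedBall a.2 (ε a.2))) := by
    refine dense_biInter_of_isOpen (fun a _ => isOpen_awayFromZero _ _ _)
      I.finite_toSet.countable fun a ha => ?_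
    obtain ⟨h1, h2⟩ := hI a ha
    exact dense_awayFromZero hs (by omega) h2 (Metric.isClosed_closedBall.isCompact)
      (hball a.2)
  obtain ⟨ψ, hψball, hψ⟩ := Metric.dense_iff.1 hd φ η hη
  simp only [Set.mem_iInter] at hψ
  refine ⟨ψ, fun i x => ?_, ?_⟩
  · rw [← Real.dist_eq]
    exact (ContinuousMap.dist_apply_le_dist _).trans_lt ((dist_le_pi_dist ψ φ i).trans_lt hψball)
  choose! κ hκ hκ' using hψ
  obtain ⟨κ₀, hκ₀, hle⟩ : ∃ κ₀ > 0, ∀ a ∈ I, κ₀ ≤ κ a := by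
    rcases I.eq_empty_or_nonempty with hE | hne
    · exact ⟨1, one_pos, by simp [hE]⟩
    · obtain ⟨a, ha, hmin⟩ := Finset.exists_min_image I κ hne
      exact ⟨κ a, hκ a ha, hmin⟩
  refine ⟨κ₀, hκ₀, fun x S hS => ?_⟩
  by_contra! hcard
  obtain ⟨S', hS', hcard'⟩ := Finset.exists_subset_card_eq hcard
  have hx := ht (Set.mem_univ x)
  simp only [Set.mem_iUnion] at hx
  obtain ⟨y, hy, hxy⟩ := hx
  have ha : (S', y) ∈ I := by
    refine Finset.mem_product.2 ⟨Finset.mem_powersetCard.2 ⟨fun p hp => ?_, hcard'⟩, hy⟩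
    have := (hS p (hS' hp)).1
    simp; omega
  obtain ⟨p, hp, hlt⟩ := hκ' (S', y) ha x hxy
  have h1 := (hS p (hS' hp)).2
  have h2 := hle _ ha
  linarith

/-! ### Integer iterates and return times -/

lemma zpow_apply_add (f : K ≃ₜ K) (j k : ℤ) (x : K) : (f ^ (j + k)) x = (f ^ j) ((f ^ k) x) := by
  rw [zpow_add]; rfl

lemma zpow_apply_zero (f : K ≃ₜ K) (x : K) : (f ^ (0 : ℤ)) x = x := by
  rw [zpow_zero]; rfl

lemma zpow_apply_natCast (f : K ≃ₜ K) (n : ℕ) (x : K) : (f ^ (n : ℤ)) x = f^[n] x := by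
  induction n with
  | zero => exact zpow_apply_zero f x
  | succ n ih =>
    rw [Function.iterate_succ_apply', ← ih, Nat.cast_succ, add_comm, zpow_apply_add, zpow_one]

lemma toEquiv_zpow_apply (f : K ≃ₜ K) (j : ℤ) (x : K) : (f.toEquiv ^ j) x = (f ^ j) x := by
  let F : (K ≃ₜ K) →* Equiv.Perm K :=
    { toFun := Homeomorph.toEquiv, map_one' := rfl, map_mul' := fun _ _ => rfl }
  exact (DFunLike.congr_fun (map_zpow F f j) x).symm

/-- Under a minimal homeomorphism, forward return times to an open set are bounded. -/
lemma exists_forward_visit {f : K ≃ₜ K} (hmin : ∀ x, Dense (Set.range fun n : ℤ => (f ^ n) x))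
    {V : Set K} (hV : IsOpen V) (hne : V.Nonempty) : ∃ r : ℕ, ∀ x, ∃ k ≤ r, f^[k] x ∈ V := by
  obtain ⟨t, ht⟩ := isCompact_univ.elim_finite_subcover (fun j : ℤ => (f ^ j) ⁻¹' V)
    (fun j => hV.preimage (f ^ j).continuous) (by
      intro x _
      obtain ⟨_, hyV, j, rfl⟩ := (hmin x).inter_open_nonempty V hV hne
      exact Set.mem_iUnion.2 ⟨j, hyV⟩)
  let R := t.sup Int.natAbs
  refine ⟨2 * R, fun x => ?_⟩
  have hx := ht (Set.mem_univ ((f ^ (R : ℤ)) x))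
  simp only [Set.mem_iUnion, Set.mem_preimage] at hx
  obtain ⟨j, hj, hx⟩ := hx
  have hjR : j.natAbs ≤ R := Finset.le_sup (f := Int.natAbs) hj
  refine ⟨(j + R).toNat, by omega, ?_⟩
  rw [← zpow_apply_add] at hx
  rwa [← zpow_apply_natCast, Int.toNat_of_nonneg (by omega)]

/-! ### Separated markers -/

/-- The part of the space which is not yet occupied by the first markers: `vacant f J c i` vanishes
at the points within time `J` of a full marker of index smaller than `i`. -/
noncomputable def vacant (f : K ≃ₜ K) (J : ℕ) (c : ℕ → K → ℝ) : ℕ → K → ℝ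
  | 0, _ => 1
  | i + 1, x => vacant f J c i x *
      ∏ j ∈ Finset.Ioo (-(J : ℤ)) J, (1 - c i ((f ^ j) x) * vacant f J c i ((f ^ j) x))

section Vacant

variable {f : K ≃ₜ K} {J : ℕ} {c : ℕ → K → ℝ}

lemma vacant_mem_Icc (hc : ∀ i x, c i x ∈ Set.Icc (0 : ℝ) 1) (i : ℕ) (x : K) :
    vacant f J c i x ∈ Set.Icc (0 : ℝ) 1 := by
  induction i generalizing x with
  | zero => simp [vacant]
  | succ i ih =>
    have h1 : ∀ y, 1 - c i y * vacant f J c i y ∈ Set.Icc (0 : ℝ) 1 := fun y =>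
      ⟨sub_nonneg.2 (mul_le_one₀ (hc i y).2 (ih y).1 (ih y).2),
        sub_le_self _ (mul_nonneg (hc i y).1 (ih y).1)⟩
    refine ⟨mul_nonneg (ih x).1 (Finset.prod_nonneg fun j _ => (h1 _).1), ?_⟩
    exact mul_le_one₀ (ih x).2 (Finset.prod_nonneg fun j _ => (h1 _).1)
      (Finset.prod_le_one (fun j _ => (h1 _).1) fun j _ => (h1 _).2)

lemma continuous_vacant (hc : ∀ i, Continuous (c i)) (i : ℕ) : Continuous (vacant f J c i) := by
  induction i with
  | zero => exact continuous_const
  | succ i ih =>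
    refine ih.mul (continuous_finsetProd _ fun j _ => continuous_const.sub ?_)
    exact ((hc i).comp (f ^ j).continuous).mul (ih.comp (f ^ j).continuous)

lemma vacant_le_one_sub (hc : ∀ i x, c i x ∈ Set.Icc (0 : ℝ) 1) {i' i : ℕ} (h : i' < i) (x : K)
    {j : ℤ} (hj : |j| < J) :
    vacant f J c i x ≤ 1 - c i' ((f ^ j) x) * vacant f J c i' ((f ^ j) x) := by
  have h01 : ∀ i y, 1 - c i y * vacant f J c i y ∈ Set.Icc (0 : ℝ) 1 := fun i y =>
    ⟨sub_nonneg.2 (mul_le_one₀ (hc i y).2 (vacant_mem_Icc hc i y).1 (vacant_mem_Icc hc i y).2),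
      sub_le_self _ (mul_nonneg (hc i y).1 (vacant_mem_Icc hc i y).1)⟩
  induction i, h using Nat.le_induction with
  | base =>
    have hmem : j ∈ Finset.Ioo (-(J : ℤ)) J := by rw [Finset.mem_Ioo]; exact abs_lt.1 hj
    rw [Nat.succ_eq_add_one, vacant]
    have h1 : ∏ j ∈ Finset.Ioo (-(J : ℤ)) J,
        (1 - c i' ((f ^ j) x) * vacant f J c i' ((f ^ j) x))
          ≤ 1 - c i' ((f ^ j) x) * vacant f J c i' ((f ^ j) x) := by
      rw [← Finset.mul_prod_erase _ _ hmem]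
      exact mul_le_of_le_one_right (h01 _ _).1
        (Finset.prod_le_one (fun j _ => (h01 _ _).1) fun j _ => (h01 _ _).2)
    exact (mul_le_of_le_one_left (Finset.prod_nonneg fun j _ => (h01 _ _).1)
      (vacant_mem_Icc hc i' x).2).trans h1
  | succ i hi ih =>
    refine le_trans ?_ ih
    rw [vacant]
    exact mul_le_of_le_one_right (vacant_mem_Icc hc i x).1
      (Finset.prod_le_one (fun j _ => (h01 _ _).1) fun j _ => (h01 _ _).2)

lemma vacant_eq_zero_or_one (i : ℕ) (y : K)
    (h : ∀ i' < i, ∀ j : ℤ, |j| ≤ i * J → c i' ((f ^ j) y) = 0 ∨ c i' ((f ^ j) y) = 1) :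
    vacant f J c i y = 0 ∨ vacant f J c i y = 1 := by
  induction i generalizing y with
  | zero => right; rfl
  | succ i ih =>
    have hle : (i : ℤ) * J ≤ (i + 1 : ℕ) * J := by push_cast; nlinarith
    have h0 := ih y fun i' hi' j hj => h i' (by omega) j (hj.trans hle)
    have h1 : ∀ j ∈ Finset.Ioo (-(J : ℤ)) J,
        1 - c i ((f ^ j) y) * vacant f J c i ((f ^ j) y) = 0 ∨
        1 - c i ((f ^ j) y) * vacant f J c i ((f ^ j) y) = 1 := by
      intro j hj
      have hj : |j| < J := by rw [Finset.mem_Ioo] at hj; exact abs_lt.2 hj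
      have hs := ih ((f ^ j) y) fun i' hi' j' hj' => by
        rw [← zpow_apply_add]
        refine h i' (by omega) _ ((abs_add_le _ _).trans ?_)
        push_cast
        linarith
      have hci := h i (by omega) j (by push_cast; nlinarith)
      rcases hs with hs | hs <;> rcases hci with hci | hci <;> simp [hs, hci]
    have h2 : ∏ j ∈ Finset.Ioo (-(J : ℤ)) J,
        (1 - c i ((f ^ j) y) * vacant f J c i ((f ^ j) y)) = 0 ∨
        ∏ j ∈ Finset.Ioo (-(J : ℤ)) J,
        (1 - c i ((f ^ j) y) * vacant f J c i ((f ^ j) y)) = 1 := by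
      by_cases hz : ∃ j ∈ Finset.Ioo (-(J : ℤ)) J,
          1 - c i ((f ^ j) y) * vacant f J c i ((f ^ j) y) = 0
      · obtain ⟨j, hj, hz⟩ := hz
        exact Or.inl (Finset.prod_eq_zero hj hz)
      · push Not at hz
        exact Or.inr (Finset.prod_eq_one fun j hj => (h1 j hj).resolve_left (hz j hj))
    rw [vacant]
    rcases h0 with h0 | h0 <;> rcases h2 with h2 | h2 <;> simp [h0, h2]

lemma exists_marker_of_vacant_eq_zero (i : ℕ) (y : K) (h : vacant f J c i y = 0) :
    ∃ i' < i, ∃ j : ℤ, |j| < J ∧ c i' ((f ^ j) y) * vacant f J c i' ((f ^ j) y) = 1 := by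
  induction i with
  | zero => simp [vacant] at h
  | succ i ih =>
    rw [vacant, mul_eq_zero, Finset.prod_eq_zero_iff] at h
    rcases h with h | ⟨j, hj, h⟩
    · obtain ⟨i', hi', h⟩ := ih h
      exact ⟨i', by omega, h⟩
    · rw [Finset.mem_Ioo] at hj
      exact ⟨i, by omega, j, abs_lt.2 hj, by linarith⟩

end Vacant

/-- Given functions `c i`, there are continuous markers `σ i` supported in the supports of the
`c i`, such that distinct markers on an orbit are at time distance at least `J`, and full markers
occur near the points where some `c i` is full and no function is ambiguous. -/
lemma exists_markers (f : K ≃ₜ K) {J : ℕ} (hJ : 0 < J) (q : ℕ) (c : ℕ → C(K, ℝ))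
    (hc : ∀ i x, c i x ∈ Set.Icc (0 : ℝ) 1)
    (hsep : ∀ i x, ∀ j : ℤ, j ≠ 0 → |j| < J → 0 < c i x → ¬ 0 < c i ((f ^ j) x)) :
    ∃ σ : ℕ → C(K, ℝ), (∀ i x, σ i x ∈ Set.Icc (0 : ℝ) 1) ∧ (∀ i x, 0 < σ i x → 0 < c i x) ∧
      (∀ i i' x, ∀ j : ℤ, |j| < J → 0 < σ i x → 0 < σ i' ((f ^ j) x) → i = i' ∧ j = 0) ∧
      ∀ y, ∀ i < q, c i y = 1 →
        (∀ i' < q, ∀ j : ℤ, |j| ≤ q * J → c i' ((f ^ j) y) = 0 ∨ c i' ((f ^ j) y) = 1) →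
        ∃ i' < q, ∃ j : ℤ, |j| < J ∧ σ i' ((f ^ j) y) = 1 := by
  let G : ℕ → K → ℝ := vacant f J fun i => c i
  have hG : ∀ i x, G i x ∈ Set.Icc (0 : ℝ) 1 := vacant_mem_Icc hc
  have hGc : ∀ i, Continuous (G i) := continuous_vacant fun i => (c i).continuous
  let σ : ℕ → C(K, ℝ) := fun i => ⟨fun x => max 0 (2 * (c i x * G i x) - 1), by
    have := hGc i
    fun_prop⟩
  have hσ : ∀ i x, σ i x = max 0 (2 * (c i x * G i x) - 1) := fun _ _ => rfl
  have hhalf : ∀ i x, 0 < σ i x → 1 / 2 < c i x * G i x := by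
    intro i x h
    rw [hσ, lt_max_iff] at h
    rcases h with h | h
    · exact absurd h (lt_irrefl _)
    · linarith
  have hcpos : ∀ i x, 0 < σ i x → 0 < c i x := by
    intro i x h
    have h1 := hhalf i x h
    refine (hc i x).1.lt_of_ne fun h0 => ?_
    rw [← h0] at h1
    norm_num at h1
  have hle : ∀ i x, c i x * G i x ≤ 1 := fun i x => mul_le_one₀ (hc i x).2 (hG i x).1 (hG i x).2
  have horder : ∀ i i' x, ∀ j : ℤ, |j| < J → 0 < σ i x → 0 < σ i' ((f ^ j) x) → ¬ i' < i := by
    intro i i' x j hj h h' hlt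
    have h1 := hhalf _ _ h
    have h2 := hhalf _ _ h'
    have h3 : G i x ≤ 1 - c i' ((f ^ j) x) * G i' ((f ^ j) x) := vacant_le_one_sub hc hlt x hj
    have h4 : c i x * G i x ≤ G i x := mul_le_of_le_one_left (hG i x).1 (hc i x).2
    linarith
  refine ⟨σ, fun i x => ⟨le_max_left _ _, max_le zero_le_one (by linarith [hle i x])⟩, hcpos,
    fun i i' x j hj h h' => ?_, fun y i hi hy hloc => ?_⟩
  · have hii : i = i' := by
      refine le_antisymm (not_lt.1 (horder i i' x j hj h h')) (not_lt.1 ?_)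
      refine horder i' i ((f ^ j) x) (-j) (by rwa [abs_neg]) h' ?_
      rwa [← zpow_apply_add, neg_add_cancel, zpow_apply_zero]
    subst hii
    refine ⟨rfl, ?_⟩
    by_contra hj0
    exact hsep i x j hj0 hj (hcpos _ _ h) (hcpos _ _ h')
  · have hfull : ∀ i' x, c i' x * G i' x = 1 → σ i' x = 1 := by
      intro i' x h
      rw [hσ, h]; norm_num
    have hiq : (i : ℤ) * J ≤ q * J := by gcongr
    have h01 : G i y = 0 ∨ G i y = 1 := vacant_eq_zero_or_one i y fun i' hi' j hj =>
      hloc i' (by omega) j (hj.trans hiq)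
    rcases h01 with h0 | h1
    · obtain ⟨i', hi', j, hj, h⟩ := exists_marker_of_vacant_eq_zero i y h0
      exact ⟨i', by omega, j, hj, hfull _ _ h⟩
    · refine ⟨i, hi, 0, by simpa using hJ, hfull _ _ ?_⟩
      rw [zpow_apply_zero, hy, h1, one_mul]

/-! ### Growth of cocycles with sparse perturbations -/

lemma cocycle_congr (f : K ≃ₜ K) {A B : C(K, SL2)} {n : ℕ} {x : K}
    (h : ∀ t < n, B (f^[t] x) = A (f^[t] x)) : cocycle f B n x = cocycle f A n x := by
  rw [cocycle_eq_iterProd, cocycle_eq_iterProd]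
  exact iterProd_congr h

/-- If the times at which `B` differs from `A` are contained in windows of length `ℓ`, at time
distance at least `m`, then the growth of `B` on short segments is controlled by that of `A`. -/
lemma norm_cocycle_le_of_sparse {f : K ≃ₜ K} {A B : C(K, SL2)} {μ C C₁ : ℝ} (hC : 1 ≤ C)
    (hC₁ : 1 ≤ C₁) (hμ : 0 < μ) (hA : ∀ n x, ‖(cocycle f A n x : M2)‖ ≤ C * Real.exp (μ * n))
    (hB : ∀ x, ‖(B x : M2)‖ ≤ C₁) {ℓ m : ℕ}
    (hsparse : ∀ x, B x ≠ A x → ∀ t, ℓ ≤ t → t < m → B (f^[t] x) = A (f^[t] x))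
    {n : ℕ} (hn : n ≤ m) (x : K) :
    ‖(cocycle f B n x : M2)‖ ≤ C ^ 2 * C₁ ^ ℓ * Real.exp (μ * n) := by
  have hCC : C ≤ C ^ 2 * C₁ ^ ℓ := by
    have : 1 ≤ C₁ ^ ℓ := one_le_pow₀ hC₁
    nlinarith
  by_cases hex : ∃ t, t < n ∧ B (f^[t] x) ≠ A (f^[t] x)
  · classical
    obtain ⟨ht, hne⟩ := Nat.find_spec hex
    set a := Nat.find hex with ha
    have hfirst : ∀ t < a, B (f^[t] x) = A (f^[t] x) := by
      intro t hta
      by_contra hcon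
      exact Nat.find_min hex hta ⟨by omega, hcon⟩
    set w := min ℓ (n - a) with hw
    have hsplit : n = (n - a - w) + (w + a) := by omega
    have hrest : cocycle f B (n - a - w) (f^[w + a] x) = cocycle f A (n - a - w) (f^[w + a] x) := by
      refine cocycle_congr f fun t htw => ?_
      have := hsparse _ hne (t + w) (by omega) (by omega)
      rwa [← Function.iterate_add_apply, add_assoc, Function.iterate_add_apply] at this
    have hprod : cocycle f B n x = cocycle f A (n - a - w) (f^[w + a] x) *
        (cocycle f B w (f^[a] x) * cocycle f A a x) := by
      conv_lhs => rw [hsplit]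
      rw [cocycle_add, cocycle_add, hrest, cocycle_congr f hfirst]
    rw [hprod, Matrix.SpecialLinearGroup.coe_mul, Matrix.SpecialLinearGroup.coe_mul]
    calc _ ≤ _ := norm_mul_le _ _
      _ ≤ (C * Real.exp (μ * (n - a - w : ℕ))) * (C₁ ^ ℓ * (C * Real.exp (μ * a))) := by
        gcongr
        · exact hA _ _
        · refine (norm_mul_le _ _).trans ?_
          gcongr
          · refine (norm_cocycle_le_pow f hB _ _).trans ?_
            exact pow_le_pow_right₀ hC₁ (by omega)
          · exact hA _ _
      _ = C ^ 2 * C₁ ^ ℓ * Real.exp (μ * (n - a - w : ℕ) + μ * a) := by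
        rw [Real.exp_add]; ring
      _ ≤ _ := by
        gcongr
        rw [← mul_add]
        gcongr
        exact_mod_cast (by omega : n - a - w + a ≤ n)
  · push Not at hex
    rw [cocycle_congr f hex]
    refine (hA _ _).trans ?_
    gcongr

lemma norm_cocycle_le_pow_of_short {f : K ≃ₜ K} {B : C(K, SL2)} {μ D : ℝ} (hD : 1 ≤ D) {m : ℕ}
    (h : ∀ n ≤ m, ∀ x, ‖(cocycle f B n x : M2)‖ ≤ D * Real.exp (μ * n)) (k : ℕ) :
    ∀ n ≤ k * m, ∀ x, ‖(cocycle f B n x : M2)‖ ≤ D ^ k * Real.exp (μ * n) := by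
  induction k with
  | zero =>
    intro n hn x
    obtain rfl : n = 0 := by simpa using hn
    simp [cocycle]
  | succ k ih =>
    intro n hn x
    obtain ⟨a, b, rfl, ha, hb⟩ : ∃ a b, n = a + b ∧ a ≤ m ∧ b ≤ k * m := by
      rcases le_total n m with h | h
      · exact ⟨n, 0, rfl, h, Nat.zero_le _⟩
      · refine ⟨m, n - m, by omega, le_rfl, ?_⟩
        rw [add_mul, one_mul] at hn
        omega
    rw [cocycle_add, Matrix.SpecialLinearGroup.coe_mul]
    calc _ ≤ _ := norm_mul_le _ _
      _ ≤ (D * Real.exp (μ * a)) * (D ^ k * Real.exp (μ * b)) := by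
        gcongr
        · exact h a ha _
        · exact ih b hb _
      _ = _ := by push_cast; rw [mul_add, Real.exp_add]; ring

lemma norm_cocycle_mul_le_exp_sum (f : K ≃ₜ K) (B : C(K, SL2)) (H : ℕ) (x : K) {w : ℕ → ℝ}
    {n : ℕ} (h : ∀ b < n, ‖(cocycle f B H (f^[H * b] x) : M2)‖ ≤ Real.exp (w b)) :
    ‖(cocycle f B (H * n) x : M2)‖ ≤ Real.exp (∑ b ∈ Finset.range n, w b) := by
  induction n with
  | zero => simp [cocycle]
  | succ n ih =>
    rw [show H * (n + 1) = H + H * n by ring, cocycle_add, Matrix.SpecialLinearGroup.coe_mul,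
      Finset.sum_range_succ, add_comm (∑ b ∈ Finset.range n, w b), Real.exp_add]
    refine (norm_mul_le _ _).trans ?_
    gcongr
    · exact h n (by omega)
    · exact ih fun b hb => h b (by omega)

/-- If `B` has moderate growth on short segments and is contracted on some subsegment of all but a
few blocks, then the overall growth rate is smaller than expected. -/
lemma mem_growthBelow_of_blocks {f : K ≃ₜ K} {B : C(K, SL2)} {μ D : ℝ} (hD : 1 ≤ D)
    (hμ : 0 < μ) {m : ℕ} (hm : 0 < m) (hDm : D ^ 11 ≤ Real.exp (μ * m / 4))
    (hshort : ∀ n ≤ m, ∀ x, ‖(cocycle f B n x : M2)‖ ≤ D * Real.exp (μ * n))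
    {full : K → Prop}
    (hfull : ∀ z, full z → ‖(cocycle f B (2 * m) z : M2)‖ ≤ D * Real.exp (μ * m))
    {n e : ℕ} (hn : 2 * e < n)
    (hbad : ∀ x, ∀ S ⊆ Finset.range n,
      (∀ b ∈ S, ¬ ∃ t ≤ 5 * m, full (f^[t] (f^[7 * m * b] x))) → S.card ≤ e) :
    B ∈ growthBelow f (27 / 28 * μ) := by
  classical
  refine ⟨7 * m * n, by have : 0 < n := by omega
                        positivity, fun x => ?_⟩
  have hlong := norm_cocycle_le_pow_of_short hD hshort
  let S := (Finset.range n).filter fun b => ¬ ∃ t ≤ 5 * m, full (f^[t] (f^[7 * m * b] x))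
  have hS : S.card ≤ e := hbad x S (Finset.filter_subset _ _) fun b hb => (Finset.mem_filter.1 hb).2
  let w : ℕ → ℝ := fun b => if b ∈ S then 29 / 4 * (μ * m) else 25 / 4 * (μ * m)
  have hw : ∀ b < n, ‖(cocycle f B (7 * m) (f^[7 * m * b] x) : M2)‖ ≤ Real.exp (w b) := by
    intro b hb
    set y := f^[7 * m * b] x with hy
    by_cases hbS : b ∈ S
    · simp only [w, if_pos hbS]
      refine (hlong 7 (7 * m) le_rfl y).trans ?_
      calc _ ≤ Real.exp (μ * m / 4) * Real.exp (μ * (7 * m : ℕ)) := by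
            gcongr
            exact (pow_le_pow_right₀ hD (by norm_num)).trans hDm
        _ = _ := by rw [← Real.exp_add]; push_cast; ring_nf
    · simp only [w, if_neg hbS]
      have : ∃ t ≤ 5 * m, full (f^[t] y) := by
        by_contra hcon
        exact hbS (Finset.mem_filter.2 ⟨Finset.mem_range.2 hb, hcon⟩)
      obtain ⟨t, ht, hft⟩ := this
      have hsplit : 7 * m = (5 * m - t) + (2 * m + t) := by omega
      have hprod : cocycle f B (7 * m) y = cocycle f B (5 * m - t) (f^[2 * m + t] y) *
          (cocycle f B (2 * m) (f^[t] y) * cocycle f B t y) := by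
        conv_lhs => rw [hsplit]
        rw [cocycle_add, cocycle_add]
      rw [hprod, Matrix.SpecialLinearGroup.coe_mul, Matrix.SpecialLinearGroup.coe_mul]
      calc _ ≤ _ := norm_mul_le _ _
        _ ≤ (D ^ 5 * Real.exp (μ * (5 * m - t : ℕ))) *
            ((D * Real.exp (μ * m)) * (D ^ 5 * Real.exp (μ * t))) := by
          gcongr
          · exact hlong 5 _ (by omega) _
          · refine (norm_mul_le _ _).trans ?_
            gcongr
            · exact hfull _ hft
            · exact hlong 5 _ ht _
        _ = D ^ 11 * Real.exp (6 * (μ * m)) := by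
          rw [show 6 * (μ * m) = μ * (5 * m - t : ℕ) + μ * m + μ * t by
            rw [Nat.cast_sub ht]; push_cast; ring, Real.exp_add, Real.exp_add]
          ring
        _ ≤ Real.exp (μ * m / 4) * Real.exp (6 * (μ * m)) := by gcongr
        _ = _ := by rw [← Real.exp_add]; ring_nf
  refine (norm_cocycle_mul_le_exp_sum f B (7 * m) x hw).trans_lt (Real.exp_lt_exp.2 ?_)
  have hsum : ∑ b ∈ Finset.range n, w b = 25 / 4 * (μ * m) * n + S.card * (μ * m) := by
    have h1 : ∀ b, w b = 25 / 4 * (μ * m) + if b ∈ S then μ * m else 0 := by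
      intro b
      simp only [w]
      split_ifs <;> ring
    have h2 : Finset.range n ∩ S = S :=
      Finset.inter_eq_right.2 (Finset.filter_subset _ _)
    simp only [h1, Finset.sum_add_distrib, Finset.sum_const, Finset.card_range, nsmul_eq_mul,
      Finset.sum_ite_mem, h2]
    ring
  rw [hsum]
  have hSn : 2 * (S.card : ℝ) < n := by exact_mod_cast (by omega : 2 * S.card < n)
  have hμm : 0 < μ * m := by positivity
  push_cast
  nlinarith

/-- Counting lemma: if each bad block is witnessed by an event near it and there are few events,
there are few bad blocks. -/
lemma card_le_of_witness {ι : Type*} [DecidableEq ι] {m q d : ℕ} (hm : 0 < m) {S : Finset ℕ}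
    (P : ι × ℕ → Prop) (hP : ∀ R : Finset (ι × ℕ), (∀ p ∈ R, P p) → R.card ≤ d)
    (hS : ∀ b ∈ S, ∃ p, P p ∧ 7 * m * b + 2 * m ≤ p.2 ∧
      p.2 ≤ 7 * m * b + 3 * m + 4 * q * m) : S.card ≤ (q + 1) * d := by
  rcases S.eq_empty_or_nonempty with rfl | ⟨b₁, hb₁⟩
  · simp
  have : Nonempty (ι × ℕ) := ⟨(hS b₁ hb₁).choose⟩
  choose! g hg h1 h2 using hS
  refine (Finset.card_le_mul_card_image S (q + 1) (f := g) fun p _ => ?_).trans ?_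
  · rcases (S.filter fun b => g b = p).eq_empty_or_nonempty with h | h
    · simp [h]
    · obtain ⟨b₀, hb₀, hmin⟩ := Finset.exists_min_image _ id h
      have : (S.filter fun b => g b = p) ⊆ Finset.Icc b₀ (b₀ + q) := by
        intro b hb
        refine Finset.mem_Icc.2 ⟨hmin b hb, ?_⟩
        rw [Finset.mem_filter] at hb hb₀
        have e1 := h1 b hb.1
        have e2 := h2 b₀ hb₀.1
        rw [hb.2] at e1
        rw [hb₀.2] at e2
        have e3 : m * (7 * b + 2) ≤ m * (7 * b₀ + 3 + 4 * q) := by nlinarith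
        have := Nat.le_of_mul_le_mul_left e3 hm
        omega
      exact (Finset.card_le_card this).trans (by simp; omega)
  · gcongr
    refine hP _ fun p hp => ?_
    obtain ⟨b, hb, rfl⟩ := Finset.mem_image.1 hp
    exact hg b hb

/-! ### Normalization to determinant one -/

/-- The rescaling of a matrix of positive determinant to determinant one. -/
noncomputable def unimod (M : M2) : SL2 :=
  if h : 0 < M.det then (⟨(√M.det)⁻¹ • M, by
    rw [Matrix.det_smul, Fintype.card_fin, inv_pow, Real.sq_sqrt h.le,
      inv_mul_cancel₀ h.ne']⟩ : SL2)
  else 1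

lemma coe_unimod {M : M2} (h : 0 < M.det) : (unimod M : M2) = (√M.det)⁻¹ • M := by
  have : unimod M = _ := dif_pos h
  rw [this]

lemma unimod_coe (E : SL2) : unimod (E : M2) = E := by
  apply Subtype.ext
  have := coe_unimod (M := (E : M2)) (by simp)
  simpa using this

lemma continuous_unimod_comp {X : Type*} [TopologicalSpace X] {g : X → M2} (hg : Continuous g)
    (h : ∀ x, 0 < (g x).det) : Continuous fun x => unimod (g x) := by
  rw [isInducing_coe_SL2.continuous_iff]
  have : ((fun M : SL2 => (M : M2)) ∘ fun x => unimod (g x)) =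
      fun x => (√(g x).det)⁻¹ • g x := by
    funext x
    exact coe_unimod (h x)
  rw [this]
  have hd : Continuous fun x => (g x).det := hg.matrix_det
  exact (hd.sqrt.inv₀ fun x => (Real.sqrt_pos.2 (h x)).ne').smul hg

lemma exists_unimod_near {δ : ℝ} (hδ : 0 < δ) :
    ∃ θ > 0, ∀ M : M2, ‖M - 1‖ ≤ θ → 0 < M.det ∧ ‖(unimod M : M2) - 1‖ ≤ δ := by
  have hdet : Continuous fun M : M2 => M.det := continuous_id.matrix_det
  have h1 : ∀ᶠ M : M2 in 𝓝 1, 0 < M.det :=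
    hdet.continuousAt.eventually (lt_mem_nhds (by simp))
  have hc : ContinuousAt (fun M : M2 => (√M.det)⁻¹ • M) 1 := by
    refine ContinuousAt.smul (ContinuousAt.inv₀ hdet.sqrt.continuousAt (by simp)) continuousAt_id
  have h2 : ∀ᶠ M : M2 in 𝓝 1, dist ((√M.det)⁻¹ • M) 1 < δ := by
    have := hc.eventually (Metric.ball_mem_nhds _ hδ)
    simpa using this
  obtain ⟨θ, hθ, h⟩ := Metric.nhds_basis_closedBall.eventually_iff.1 (h1.and h2)
  refine ⟨θ, hθ, fun M hM => ?_⟩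
  obtain ⟨ha, hb⟩ := h (by rwa [Metric.mem_closedBall, dist_eq_norm])
  refine ⟨ha, ?_⟩
  rw [coe_unimod ha, ← dist_eq_norm]
  exact hb.le

/-! ### Local perturbations -/

lemma continuous_coe_inv_apply (A : C(K, SL2)) :
    Continuous fun x => (((A x)⁻¹ : SL2) : M2) := by
  simp only [Matrix.SpecialLinearGroup.coe_inv]
  exact (continuous_coe_SL2.comp A.continuous).matrix_adjugate

/-- If the cocycle is not uniformly hyperbolic, then over some open set small perturbations along
an orbit segment of fixed length can send any direction to any other direction. -/
lemma exists_flexible_point {f : K ≃ₜ K} {A : C(K, SL2)} (hA : ¬ UnifHyp f A) {θ : ℝ}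
    (hθ : 0 < θ) : ∃ (ℓ : ℕ) (p : K), ∃ U ∈ 𝓝 p, ∀ y ∈ U, ∀ v v' : E2, v ≠ 0 → v' ≠ 0 →
      ∃ E : ℕ → SL2, (∀ k < ℓ, ‖(E k : M2) - 1‖ ≤ θ) ∧
        ∃ c : ℝ, act (iterProd (fun k => A (f^[k] y) * E k) ℓ) v = c • v' := by
  set θ' := min θ 1 / 3 with hθ'def
  have hθ' : 0 < θ' := by positivity
  have hθ'1 : θ' ≤ 1 := by have := min_le_right θ 1; rw [hθ'def]; linarith
  have hθ'3 : 3 * θ' ≤ θ := by have := min_le_left θ 1; rw [hθ'def]; linarith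
  obtain ⟨n, hn⟩ := exists_nat_ge (max 1 (2 / θ' ^ 2))
  have hn0 : 0 < n := by
    have : (1 : ℝ) ≤ n := (le_max_left _ _).trans hn
    exact_mod_cast this
  obtain ⟨p, w, hw, hmax⟩ := exists_max_middle f hA hn0
  have hcont : ∀ k : ℕ, Continuous fun y =>
      ‖(((A (f^[k] y))⁻¹ : SL2) : M2) * (A (f^[k] p) : M2) - 1‖ := by
    intro k
    have h1 := (continuous_coe_inv_apply A).comp (f.continuous.iterate k)
    exact ((h1.mul continuous_const).sub continuous_const).norm
  have hU : {y | ∀ k ∈ Finset.range (2 * n + 1),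
      ‖(((A (f^[k] y))⁻¹ : SL2) : M2) * (A (f^[k] p) : M2) - 1‖ < θ'} ∈ 𝓝 p := by
    refine (Filter.eventually_all_finset _).2 fun k _ => ?_
    refine (hcont k).continuousAt.eventually (gt_mem_nhds ?_)
    beta_reduce
    rw [← Matrix.SpecialLinearGroup.coe_mul, inv_mul_cancel]
    simpa using hθ'
  refine ⟨2 * n + 1, p, _, hU, fun y hy v v' hv hv' => ?_⟩
  obtain ⟨E, hE, c, hc⟩ := exists_perturb_act (fun k => A (f^[k] p)) w hw n hθ'
    ((le_max_right _ _).trans hn) hn0 (by simpa only [cocycle_eq_iterProd] using hmax) hv hv'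
  refine ⟨fun k => (A (f^[k] y))⁻¹ * (A (f^[k] p) * E k), fun k hk => ?_, c, ?_⟩
  · set X : M2 := (((A (f^[k] y))⁻¹ : SL2) : M2) * (A (f^[k] p) : M2) with hX
    have hX1 : ‖X - 1‖ < θ' := hy k (Finset.mem_range.2 hk)
    have hE1 := hE k hk
    have e : (((A (f^[k] y))⁻¹ * (A (f^[k] p) * E k) : SL2) : M2) - 1
        = (X - 1) * ((E k : M2) - 1) + (X - 1) + ((E k : M2) - 1) := by
      rw [Matrix.SpecialLinearGroup.coe_mul, Matrix.SpecialLinearGroup.coe_mul, ← mul_assoc, ← hX]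
      noncomm_ring
    rw [e]
    calc _ ≤ ‖X - 1‖ * ‖(E k : M2) - 1‖ + ‖X - 1‖ + ‖(E k : M2) - 1‖ := by
          refine (norm_add₃_le).trans ?_
          gcongr
          exact norm_mul_le _ _
      _ ≤ θ' * 1 + θ' + θ' := by
          gcongr
          exact hE1.trans hθ'1
      _ ≤ θ := by linarith
  · simpa only [mul_inv_cancel_left] using hc

/-- Near each point whose orbit passes through the flexible region, small perturbations make the
product of length `2 * m` not larger than expected for half that length. -/
lemma exists_fold_nhds {f : K ≃ₜ K} {A : C(K, SL2)} {μ C C₁ θ : ℝ} (hC : 1 ≤ C) (hC₁ : 1 ≤ C₁)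
    (hμ : 0 < μ) (hA : ∀ n x, ‖(cocycle f A n x : M2)‖ ≤ C * Real.exp (μ * n))
    (hAE : ∀ x, ∀ E : SL2, ‖(E : M2) - 1‖ ≤ θ → ‖(A x : M2) * (E : M2)‖ ≤ C₁) {ℓ m : ℕ} {z : K}
    (hz : ∀ v v' : E2, v ≠ 0 → v' ≠ 0 → ∃ E : ℕ → SL2, (∀ k < ℓ, ‖(E k : M2) - 1‖ ≤ θ) ∧
        ∃ c : ℝ, act (iterProd (fun k => A (f^[k] (f^[m] z)) * E k) ℓ) v = c • v') :
    ∃ E : ℕ → SL2, (∀ k < ℓ, ‖(E k : M2) - 1‖ ≤ θ) ∧ ∀ᶠ y in 𝓝 z,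
      ‖(cocycle f A (m - ℓ) (f^[m + ℓ] y) : M2) *
        (iterProd (fun k => A (f^[k] (f^[m] y)) * E k) ℓ : M2) * (cocycle f A m y : M2)‖
        < 3 * C ^ 2 * C₁ ^ ℓ * Real.exp (μ * m) := by
  obtain ⟨u, v, hu, hv, hfold⟩ := exists_fold (cocycle f A m z) (cocycle f A (m - ℓ) (f^[m + ℓ] z))
  obtain ⟨E, hE, hc⟩ := hz u v hu hv
  refine ⟨E, hE, ?_⟩
  have hiter : Continuous fun y => (iterProd (fun k => A (f^[k] (f^[m] y)) * E k) ℓ : M2) := by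
    clear hc hE hfold hz
    induction ℓ with
    | zero => exact continuous_const
    | succ ℓ ih =>
      simp only [iterProd_succ, Matrix.SpecialLinearGroup.coe_mul]
      refine Continuous.mul (Continuous.mul ?_ continuous_const) ?_
      · exact continuous_coe_SL2.comp (A.continuous.comp
          ((f.continuous.iterate ℓ).comp (f.continuous.iterate m)))
      · exact ih
  have hcont : Continuous fun y => ‖(cocycle f A (m - ℓ) (f^[m + ℓ] y) : M2) *
        (iterProd (fun k => A (f^[k] (f^[m] y)) * E k) ℓ : M2) * (cocycle f A m y : M2)‖ :=
    ((((continuous_cocycle_right f A (m - ℓ)).comp (f.continuous.iterate (m + ℓ))).mul hiter).mul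
      (continuous_cocycle_right f A m)).norm
  refine hcont.continuousAt.eventually (gt_mem_nhds ?_)
  have hP : ‖(iterProd (fun k => A (f^[k] (f^[m] z)) * E k) ℓ : M2)‖ ≤ C₁ ^ ℓ :=
    norm_iterProd_le fun k hk => by
      rw [Matrix.SpecialLinearGroup.coe_mul]
      exact hAE _ _ (hE k hk)
  have hp : 0 < C₁ ^ ℓ * Real.exp (μ * m) := by positivity
  calc _ ≤ _ := hfold _ hc
    _ ≤ C₁ ^ ℓ * (C * Real.exp (μ * m) + C * Real.exp (μ * m)) := by
      gcongr
      · exact hA _ _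
      · refine (hA _ _).trans ?_
        gcongr
        exact Nat.sub_le _ _
    _ = 2 * C * (C₁ ^ ℓ * Real.exp (μ * m)) := by ring
    _ < 3 * C ^ 2 * (C₁ ^ ℓ * Real.exp (μ * m)) := by
      gcongr 1
      nlinarith
    _ = _ := by ring

/-! ### Construction of the perturbation -/

/-- A compact set covered by prescribed balls is covered by finitely many functions supported in
these balls which along orbit segments rarely take values other than zero and one. -/
lemma exists_sharp_cover {f : K ≃ₜ K} (hper : ∀ x, ∀ n : ℕ, 0 < n → f^[n] x ≠ x)
    {d : ℕ} {s : K → EuclideanSpace ℝ (Fin d)} (hs : IsEmbedding s) {Y : Set K} (hY : IsCompact Y)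
    (hYne : Y.Nonempty) {ε : K → ℝ} (hε : ∀ z ∈ Y, 0 < ε z) :
    ∃ (q : ℕ) (y : ℕ → K), (∀ i < q, y i ∈ Y) ∧ ∀ T : ℕ, ∃ c : ℕ → C(K, ℝ),
      (∀ i x, c i x ∈ Set.Icc (0 : ℝ) 1) ∧
      (∀ i x, 0 < c i x → i < q ∧ x ∈ Metric.closedBall (y i) (ε (y i))) ∧
      (∀ z ∈ Y, ∃ i < q, c i z = 1) ∧
      ∀ x, ∀ R : Finset (ℕ × ℕ), (∀ p ∈ R, p.1 < q ∧ p.2 ≤ T ∧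
        ¬ (c p.1 (f^[p.2] x) = 0 ∨ c p.1 (f^[p.2] x) = 1)) → R.card ≤ d := by
  obtain ⟨y₀, hy₀⟩ := hYne
  obtain ⟨t, htY, ht⟩ := hY.elim_nhds_subcover (fun z => Metric.ball z (ε z / 3))
    fun z hz => Metric.ball_mem_nhds z (by have := hε z hz; positivity)
  let e := t.equivFin
  set q := t.card with hq
  let y' : Fin q → K := fun i => (e.symm i : K)
  have hy' : ∀ i, y' i ∈ Y := fun i => htY _ (e.symm i).2
  let y : ℕ → K := fun i => if h : i < q then y' ⟨i, h⟩ else y₀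
  have hyy : ∀ i : Fin q, y i = y' i := fun i => by simp [y]
  refine ⟨q, y, fun i hi => by simp only [y, dif_pos hi]; exact hy' _, fun T => ?_⟩
  obtain ⟨η, hη, hηle⟩ : ∃ η > 0, ∀ i, η ≤ ε (y' i) / 6 := by
    rcases isEmpty_or_nonempty (Fin q) with h | h
    · exact ⟨1, one_pos, fun i => h.elim i⟩
    · obtain ⟨i, hi⟩ := Finite.exists_min fun i => ε (y' i) / 6
      exact ⟨ε (y' i) / 6, by have := hε _ (hy' i); positivity, hi⟩
  let φ : Fin q → C(K, ℝ) := fun i =>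
    ⟨fun x => 2 / 3 * ε (y' i) - dist x (y' i), by fun_prop⟩
  obtain ⟨ψ, hψ, κ₀, hκ₀, hgp⟩ := exists_general_position hper hs φ T hη
  set κ := min κ₀ η with hκdef
  have hκ : 0 < κ := lt_min hκ₀ hη
  let c : ℕ → C(K, ℝ) := fun i => if h : i < q then
    ⟨fun x => max 0 (min 1 (ψ ⟨i, h⟩ x / κ)), by fun_prop⟩ else 0
  have hc : ∀ (i : Fin q) x, c i x = max 0 (min 1 (ψ i x / κ)) := fun i x => by simp [c]
  have hc0 : ∀ i x, ¬ i < q → c i x = 0 := fun i x h => by simp [c, h]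
  have hψx : ∀ i x, |ψ i x - (2 / 3 * ε (y' i) - dist x (y' i))| < η := hψ
  refine ⟨c, fun i x => ?_, fun i x h => ?_, fun z hz => ?_, fun x R hR => ?_⟩
  · by_cases hi : i < q
    · rw [hc ⟨i, hi⟩ x]
      exact ⟨le_max_left _ _, max_le zero_le_one (min_le_left _ _)⟩
    · rw [hc0 i x hi]; simp
  · have hi : i < q := by
      by_contra hi
      rw [hc0 i x hi] at h
      exact lt_irrefl _ h
    refine ⟨hi, ?_⟩
    rw [hc ⟨i, hi⟩ x, lt_max_iff, lt_min_iff] at h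
    have h1 : 0 < ψ ⟨i, hi⟩ x := by
      rcases h with h | h
      · exact absurd h (lt_irrefl _)
      · exact (div_pos_iff_of_pos_right hκ).1 h.2
    have h2 := (abs_lt.1 (hψx ⟨i, hi⟩ x)).2
    have h3 := hηle ⟨i, hi⟩
    have h4 := hε _ (hy' ⟨i, hi⟩)
    rw [hyy ⟨i, hi⟩, Metric.mem_closedBall]
    linarith
  · have := ht hz
    simp only [Set.mem_iUnion] at this
    obtain ⟨a, ha, hza⟩ := this
    have hai : y' (e ⟨a, ha⟩) = a := by simp [y']
    refine ⟨e ⟨a, ha⟩, (e ⟨a, ha⟩).2, ?_⟩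
    rw [hc]
    have h1 := (abs_lt.1 (hψx (e ⟨a, ha⟩) z)).1
    have h2 := hηle (e ⟨a, ha⟩)
    rw [hai] at h1 h2
    rw [Metric.mem_ball] at hza
    have h3 : 1 ≤ ψ (e ⟨a, ha⟩) z / κ := by
      rw [le_div_iff₀ hκ, one_mul]
      have := min_le_right κ₀ η
      linarith
    rw [min_eq_left h3, max_eq_right zero_le_one]
  · classical
    let S : Finset (Fin q × ℕ) :=
      (Finset.univ ×ˢ Finset.range (T + 1)).filter fun p => ((p.1 : ℕ), p.2) ∈ R
    have hsub : R ⊆ S.image fun p => ((p.1 : ℕ), p.2) := by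
      intro p hp
      obtain ⟨h1, h2, -⟩ := hR p hp
      refine Finset.mem_image.2 ⟨(⟨p.1, h1⟩, p.2), Finset.mem_filter.2 ⟨?_, hp⟩, rfl⟩
      simp; omega
    refine (Finset.card_le_card hsub).trans (Finset.card_image_le.trans (hgp x S fun p hp => ?_))
    obtain ⟨h1, h2⟩ := Finset.mem_filter.1 hp
    obtain ⟨-, h3, h4⟩ := hR _ h2
    refine ⟨h3, ?_⟩
    simp only [hc] at h4
    by_contra! hcon
    apply h4
    have hκ' : κ < |ψ p.1 (f^[p.2] x)| := (min_le_left _ _).trans_lt hcon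
    rcases lt_abs.1 hκ' with h | h
    · right
      have : 1 ≤ ψ p.1 (f^[p.2] x) / κ := by rw [le_div_iff₀ hκ]; linarith
      rw [min_eq_left this, max_eq_right zero_le_one]
    · left
      have : ψ p.1 (f^[p.2] x) / κ ≤ 0 := div_nonpos_of_nonpos_of_nonneg (by linarith) hκ.le
      rw [max_eq_left ((min_le_right _ _).trans this)]

/-- The perturbation of `A` which inserts the matrices `E i 0, …, E i (ℓ - 1)` from time `m` after
each marker of index `i`. -/
lemma exists_perturbed_cocycle {f : K ≃ₜ K} (A : C(K, SL2)) {θ δ : ℝ} (hδ : 0 ≤ δ)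
    (hθ : ∀ M : M2, ‖M - 1‖ ≤ θ → 0 < M.det ∧ ‖(unimod M : M2) - 1‖ ≤ δ)
    {q ℓ m : ℕ} (hm : 0 < m) (hℓ : ℓ ≤ m) {E : ℕ → ℕ → SL2}
    (hE : ∀ i < q, ∀ k < ℓ, ‖(E i k : M2) - 1‖ ≤ θ) {σ : ℕ → C(K, ℝ)}
    (hσ : ∀ i x, σ i x ∈ Set.Icc (0 : ℝ) 1)
    (hsep : ∀ i i' x, ∀ j : ℤ, |j| < (2 * m : ℕ) → 0 < σ i x → 0 < σ i' ((f ^ j) x) →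
      i = i' ∧ j = 0) :
    ∃ B : C(K, SL2), (∀ x, ∃ X : SL2, ‖(X : M2) - 1‖ ≤ δ ∧ B x = A x * X) ∧
      (∀ x, B x ≠ A x → ∀ t, ℓ ≤ t → t < m → B (f^[t] x) = A (f^[t] x)) ∧
      ∀ z, ∀ i < q, σ i z = 1 → (∀ t < m, B (f^[t] z) = A (f^[t] z)) ∧
        (∀ k < ℓ, B (f^[k] (f^[m] z)) = A (f^[k] (f^[m] z)) * E i k) ∧
        ∀ t < m - ℓ, B (f^[t] (f^[m + ℓ] z)) = A (f^[t] (f^[m + ℓ] z)) := by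
  let I := Finset.range q ×ˢ Finset.range ℓ
  let back : ℕ → K → K := fun k x => (f ^ (-((m : ℤ) + k))) x
  let M : K → M2 := fun x => 1 + ∑ p ∈ I, σ p.1 (back p.2 x) • ((E p.1 p.2 : M2) - 1)
  have hback : ∀ (j : ℤ) (k k' : ℕ) x,
      back k' ((f ^ j) x) = (f ^ (j + k - k')) (back k x) := by
    intro j k k' x
    simp only [back]
    rw [← zpow_apply_add, ← zpow_apply_add]
    congr 2
    ring
  have huniq : ∀ (j : ℤ) (i k i' k' : ℕ) x, |j + k - k'| < (2 * m : ℕ) → 0 < σ i (back k x) →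
      0 < σ i' (back k' ((f ^ j) x)) → i = i' ∧ j + k - k' = 0 := by
    intro j i k i' k' x hj h h'
    rw [hback j k k' x] at h'
    exact hsep _ _ _ _ hj h h'
  have hMone : ∀ x, (∀ i < q, ∀ k < ℓ, ¬ 0 < σ i (back k x)) → M x = 1 := by
    intro x h
    simp only [M]
    rw [Finset.sum_eq_zero, add_zero]
    intro p hp
    simp only [I, Finset.mem_product, Finset.mem_range] at hp
    have : σ p.1 (back p.2 x) = 0 :=
      le_antisymm (not_lt.1 (h _ hp.1 _ hp.2)) (hσ _ _).1
    rw [this, zero_smul]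
  have hMsingle : ∀ x, ∀ i < q, ∀ k < ℓ, 0 < σ i (back k x) →
      M x = 1 + σ i (back k x) • ((E i k : M2) - 1) := by
    intro x i hi k hk h
    simp only [M]
    rw [Finset.sum_eq_single (i, k)]
    · intro p hp hne
      simp only [I, Finset.mem_product, Finset.mem_range] at hp
      have : σ p.1 (back p.2 x) = 0 := by
        refine le_antisymm (not_lt.1 fun hpos => hne ?_) (hσ _ _).1
        obtain ⟨h1, h2⟩ := huniq 0 i k p.1 p.2 x (by rw [abs_lt]; omega) h
          (by rwa [zpow_apply_zero])
        exact Prod.ext h1.symm (by omega)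
      rw [this, zero_smul]
    · intro hnot
      simp [I] at hnot
      omega
  have hM : ∀ x, ‖M x - 1‖ ≤ θ ∨ M x = 1 := by
    intro x
    by_cases h : ∃ i < q, ∃ k < ℓ, 0 < σ i (back k x)
    · obtain ⟨i, hi, k, hk, h⟩ := h
      left
      rw [hMsingle x i hi k hk h, add_sub_cancel_left, norm_smul, Real.norm_of_nonneg h.le]
      exact (mul_le_of_le_one_left (norm_nonneg _) (hσ _ _).2).trans (hE i hi k hk)
    · push Not at h
      exact Or.inr (hMone x fun i hi k hk => not_lt.2 (h i hi k hk))
  have hunimod_one : unimod (1 : M2) = 1 := by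
    simpa using unimod_coe 1
  have hMdet : ∀ x, 0 < (M x).det := by
    intro x
    rcases hM x with h | h
    · exact (hθ _ h).1
    · rw [h]; simp
  have hMcont : Continuous M := by
    refine continuous_const.add (continuous_finsetSum _ fun p _ => ?_)
    exact ((σ p.1).continuous.comp (f ^ (-((m : ℤ) + p.2))).continuous).smul continuous_const
  have hNcont : Continuous fun x => unimod (M x) := continuous_unimod_comp hMcont hMdet
  let B : C(K, SL2) := ⟨fun x => A x * unimod (M x), by
    rw [isInducing_coe_SL2.continuous_iff]
    simp only [Function.comp_def, Matrix.SpecialLinearGroup.coe_mul]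
    exact (continuous_coe_SL2.comp A.continuous).mul (continuous_coe_SL2.comp hNcont)⟩
  have hB : ∀ x, B x = A x * unimod (M x) := fun _ => rfl
  have hBA : ∀ x, (∀ i < q, ∀ k < ℓ, ¬ 0 < σ i (back k x)) → B x = A x := by
    intro x h
    rw [hB, hMone x h, hunimod_one, mul_one]
  have hz0 : ∀ z, ∀ k : ℕ, back k ((f ^ ((m : ℤ) + k)) z) = z := by
    intro z k
    simp only [back]
    rw [← zpow_apply_add, neg_add_cancel, zpow_apply_zero]
  have hmark : ∀ z i, 0 < σ i z → ∀ t : ℕ, t < 2 * m → (t < m ∨ m + ℓ ≤ t) →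
      B (f^[t] z) = A (f^[t] z) := by
    intro z i h t ht hout
    refine hBA _ fun i' hi' k' hk' hpos => ?_
    have h1 : 0 < σ i (back 0 ((f ^ ((m : ℤ) + (0 : ℕ))) z)) := by rwa [hz0]
    have h2 : (f ^ ((t : ℤ) - m)) ((f ^ ((m : ℤ) + (0 : ℕ))) z) = f^[t] z := by
      rw [← zpow_apply_add, ← zpow_apply_natCast]
      congr 2
      push_cast
      ring
    rw [← h2] at hpos
    obtain ⟨-, h3⟩ := huniq _ _ _ _ _ _ (by rw [abs_lt]; omega) h1 hpos
    omega
  refine ⟨B, fun x => ⟨unimod (M x), ?_, hB x⟩, fun x hx t ht htm => ?_, fun z i hi hz => ?_⟩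
  · rcases hM x with h | h
    · exact (hθ _ h).2
    · rw [h, hunimod_one]; simpa using hδ
  · have : ∃ i < q, ∃ k < ℓ, 0 < σ i (back k x) := by
      by_contra! hcon
      exact hx (hBA x fun i hi k hk => not_lt.2 (hcon i hi k hk))
    obtain ⟨i, hi, k, hk, h⟩ := this
    refine hBA _ fun i' hi' k' hk' hpos => ?_
    rw [← zpow_apply_natCast] at hpos
    obtain ⟨-, h3⟩ := huniq _ _ _ _ _ _ (by rw [abs_lt]; omega) h hpos
    omega
  · have hpos : 0 < σ i z := by rw [hz]; exact one_pos
    refine ⟨fun t ht => hmark z i hpos t (by omega) (Or.inl ht), fun k hk => ?_, fun t ht => ?_⟩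
    · have h1 : f^[k] (f^[m] z) = (f ^ ((m : ℤ) + k)) z := by
        rw [← Function.iterate_add_apply, ← zpow_apply_natCast]
        congr 2
        push_cast
        ring
      have h2 : M (f^[k] (f^[m] z)) = E i k := by
        rw [h1, hMsingle _ i hi k hk (by rwa [hz0]), hz0, hz, one_smul, add_sub_cancel]
      rw [hB, h2, unimod_coe]
    · rw [← Function.iterate_add_apply]
      exact hmark z i hpos _ (by omega) (Or.inr (by omega))

/-- Uniformly close maps lie in a prescribed neighborhood in the space of cocycles. -/
lemma exists_uniform_nhds (A : C(K, SL2)) {V : Set C(K, SL2)} (hV : V ∈ 𝓝 A) :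
    ∃ δ > 0, ∀ B : C(K, SL2), (∀ x, ‖(B x : M2) - (A x : M2)‖ ≤ δ) → B ∈ V := by
  let ι : C(SL2, M2) := ⟨fun M => (M : M2), continuous_coe_SL2⟩
  have hι : IsInducing ι := isInducing_coe_SL2
  have hind := ContinuousMap.isInducing_postcomp (X := K) ι hι
  rw [hind.nhds_eq_comap] at hV
  obtain ⟨W, hW, hWV⟩ := hV
  obtain ⟨δ, hδ, hball⟩ := Metric.nhds_basis_closedBall.mem_iff.1 hW
  refine ⟨δ, hδ, fun B hB => hWV (hball ?_)⟩
  rw [Metric.mem_closedBall, ContinuousMap.dist_le hδ.le]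
  intro x
  rw [dist_eq_norm]
  exact hB x

/-- A cocycle over a minimal homeomorphism without periodic points which is not uniformly hyperbolic
can be perturbed to decrease its growth rate by a definite factor. -/
theorem mem_closure_growthBelow {f : K ≃ₜ K}
    (hmin : ∀ x, Dense (Set.range fun n : ℤ => (f ^ n) x))
    (hper : ∀ x, ∀ n : ℕ, 0 < n → f^[n] x ≠ x) {d : ℕ} {s : K → EuclideanSpace ℝ (Fin d)}
    (hs : IsEmbedding s) {A : C(K, SL2)} (hA : ¬ UnifHyp f A) {μ : ℝ} (hμ : 0 < μ)
    (hAμ : A ∈ growthBelow f μ) : A ∈ closure (growthBelow f (27 / 28 * μ)) := by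
  rw [mem_closure_iff_nhds]
  intro V hV
  obtain ⟨δ₀, hδ₀, hV⟩ := exists_uniform_nhds A hV
  obtain ⟨Ca, hCa1, hCa⟩ := exists_norm_bound A
  have hCa0 : 0 < Ca := by linarith
  set δ := min 1 (δ₀ / Ca) with hδdef
  have hδ : 0 < δ := by positivity
  have hδ1 : δ ≤ 1 := min_le_left _ _
  obtain ⟨θ₀, hθ₀, hunimod⟩ := exists_unimod_near hδ
  set θ := min θ₀ 1 with hθdef
  have hθ : 0 < θ := by positivity
  obtain ⟨C, hC1, hC⟩ := exists_bound_of_growthBelow f hμ hAμ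
  set C₁ := 2 * Ca with hC₁def
  have hC₁ : 1 ≤ C₁ := by linarith
  have hnear : ∀ x, ∀ X : SL2, ‖(X : M2) - 1‖ ≤ 1 → ‖(A x : M2) * (X : M2)‖ ≤ C₁ := by
    intro x X hX
    have h1 : ‖(X : M2)‖ ≤ 2 := by
      have h2 : (X : M2) = ((X : M2) - 1) + 1 := by abel
      rw [h2]
      refine (norm_add_le _ _).trans ?_
      rw [norm_one]
      linarith
    calc _ ≤ _ := norm_mul_le _ _
      _ ≤ Ca * 2 := by gcongr; exact (hCa x).1
      _ = _ := by ring
  obtain ⟨ℓ, p, U, hU, hflex⟩ := exists_flexible_point hA hθ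
  obtain ⟨ρ, hρ, hρU⟩ := Metric.nhds_basis_closedBall.mem_iff.1 hU
  obtain ⟨r, hr⟩ := exists_forward_visit hmin (V := Metric.ball p ρ) Metric.isOpen_ball
    ⟨p, Metric.mem_ball_self hρ⟩
  set D := 3 * C ^ 2 * C₁ ^ ℓ with hD
  have hpow : 1 ≤ C ^ 2 * C₁ ^ ℓ := one_le_mul_of_one_le_of_one_le (one_le_pow₀ hC1)
    (one_le_pow₀ hC₁)
  have hD' : D = 3 * (C ^ 2 * C₁ ^ ℓ) := by rw [hD]; ring
  have hD1 : 1 ≤ D := by linarith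
  obtain ⟨N, hN⟩ := exists_const_le_exp (D ^ 11) (show 0 < μ / 4 by positivity)
  set m := N + ℓ + r + 1 with hmdef
  have hm : 0 < m := by omega
  have hDm : D ^ 11 ≤ Real.exp (μ * m / 4) := by
    rw [mul_div_right_comm]
    exact hN m (by omega)
  let Y : Set K := {z | f^[m] z ∈ Metric.closedBall p ρ}
  have hY : IsCompact Y :=
    (Metric.isClosed_closedBall.preimage (f.continuous.iterate m)).isCompact
  have hYne : Y.Nonempty := by
    refine ⟨(f ^ (-(m : ℤ))) p, ?_⟩
    change f^[m] ((f ^ (-(m : ℤ))) p) ∈ Metric.closedBall p ρ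
    rw [← zpow_apply_natCast, ← zpow_apply_add, add_neg_cancel, zpow_apply_zero]
    exact Metric.mem_closedBall_self hρ.le
  have hlocal : ∀ z ∈ Y, ∃ ε > 0, ∃ E : ℕ → SL2, (∀ k < ℓ, ‖(E k : M2) - 1‖ ≤ θ) ∧
      (∀ y ∈ Metric.closedBall z ε, ‖(cocycle f A (m - ℓ) (f^[m + ℓ] y) : M2) *
        (iterProd (fun k => A (f^[k] (f^[m] y)) * E k) ℓ : M2) * (cocycle f A m y : M2)‖
        < D * Real.exp (μ * m)) ∧
      ∀ j : ℕ, 0 < j → j ≤ 2 * m → ∀ y ∈ Metric.closedBall z ε,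
        f^[j] y ∉ Metric.closedBall z ε := by
    intro z hz
    obtain ⟨E, hE, hev⟩ := exists_fold_nhds (θ := θ) hC1 hC₁ hμ hC
      (fun x X hX => hnear x X (hX.trans (min_le_right _ _))) (ℓ := ℓ) (m := m)
      (hflex _ (hρU hz))
    obtain ⟨ε₁, hε₁, h1⟩ := Metric.nhds_basis_closedBall.eventually_iff.1 hev
    obtain ⟨ε₂, hε₂, h2⟩ := exists_ball_iterate_ne hper z (2 * m)
    refine ⟨min ε₁ ε₂, lt_min hε₁ hε₂, E, hE, fun y hy => ?_, fun j hj hjm y hy hy' => ?_⟩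
    · exact h1 (Metric.closedBall_subset_closedBall (min_le_left _ _) hy)
    · exact h2 j hjm 0 (by omega) hj.ne' y
        (Metric.closedBall_subset_closedBall (min_le_right _ _) hy) _
        (Metric.closedBall_subset_closedBall (min_le_right _ _) hy') rfl
  choose! ε hε E hE hfoldE hdisj using hlocal
  obtain ⟨q, y, hyY, hcover⟩ := exists_sharp_cover hper hs hY hYne hε
  set e := (q + 1) * d with he
  set n := 2 * e + 1 with hn
  set T := 7 * m * n + 3 * m + 4 * q * m with hT
  obtain ⟨c, hc01, hcsupp, hcfull, hcamb⟩ := hcover T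
  obtain ⟨σ, hσ01, hσc, hσsep, hσfull⟩ := exists_markers f (J := 2 * m) (by omega) q c hc01 (by
    intro i x j hj0 hj h h'
    obtain ⟨hi, hx⟩ := hcsupp i x h
    obtain ⟨-, hx'⟩ := hcsupp i _ h'
    have hd := hdisj (y i) (hyY i hi)
    rw [abs_lt] at hj
    rcases lt_or_gt_of_ne hj0 with hneg | hpos
    · refine hd j.natAbs (by omega) (by omega) _ hx' ?_
      rw [← zpow_apply_natCast, ← zpow_apply_add,
        show ((j.natAbs : ℕ) : ℤ) + j = 0 by omega, zpow_apply_zero]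
      exact hx
    · refine hd j.natAbs (by omega) (by omega) _ hx ?_
      rw [← zpow_apply_natCast, show ((j.natAbs : ℕ) : ℤ) = j by omega]
      exact hx')
  obtain ⟨B, hBnear, hBsparse, hBmark⟩ := exists_perturbed_cocycle A hδ.le (θ := θ)
    (fun M hM => hunimod M (hM.trans (min_le_left _ _))) hm (by omega : ℓ ≤ m)
    (E := fun i => E (y i)) (fun i hi => hE (y i) (hyY i hi)) hσ01 hσsep
  have hBC₁ : ∀ x, ‖(B x : M2)‖ ≤ C₁ := by
    intro x
    obtain ⟨X, hX, hBX⟩ := hBnear x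
    rw [hBX, Matrix.SpecialLinearGroup.coe_mul]
    exact hnear x X (hX.trans hδ1)
  refine ⟨B, hV B fun x => ?_, ?_⟩
  · obtain ⟨X, hX, hBX⟩ := hBnear x
    have h1 : ((A x * X : SL2) : M2) - (A x : M2) = (A x : M2) * ((X : M2) - 1) := by
      rw [Matrix.SpecialLinearGroup.coe_mul, mul_sub, mul_one]
    rw [hBX, h1]
    calc _ ≤ _ := norm_mul_le _ _
      _ ≤ Ca * (δ₀ / Ca) := by
        gcongr
        · exact (hCa x).1
        · exact hX.trans (min_le_right _ _)
      _ = δ₀ := by field_simp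
  refine mem_growthBelow_of_blocks hD1 hμ hm hDm (fun k hk x => ?_)
    (full := fun z => ∃ i < q, σ i z = 1) (fun z hz => ?_) (n := n) (e := e) (by omega)
    fun x S hS hbad => ?_
  · refine (norm_cocycle_le_of_sparse hC1 hC₁ hμ hC hBC₁ hBsparse hk x).trans ?_
    gcongr
    linarith
  · obtain ⟨i, hi, hz⟩ := hz
    obtain ⟨h1, h2, h3⟩ := hBmark z i hi hz
    have hprod : cocycle f B (2 * m) z = cocycle f A (m - ℓ) (f^[m + ℓ] z) *
        iterProd (fun k => A (f^[k] (f^[m] z)) * E (y i) k) ℓ * cocycle f A m z := by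
      rw [show 2 * m = (m - ℓ) + (ℓ + m) by omega, cocycle_add, cocycle_add, add_comm ℓ m,
        cocycle_congr f h1, cocycle_congr f h3, cocycle_eq_iterProd f B ℓ, iterProd_congr h2,
        mul_assoc]
    rw [hprod, Matrix.SpecialLinearGroup.coe_mul, Matrix.SpecialLinearGroup.coe_mul]
    have hzc := (hcsupp i z (hσc i z (by rw [hz]; exact one_pos))).2
    exact (hfoldE (y i) (hyY i hi) z hzc).le
  · let x' := (f ^ (-(2 * q * m : ℤ))) x
    refine card_le_of_witness (ι := ℕ) hm (fun p => p.1 < q ∧ p.2 ≤ T ∧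
      ¬ (c p.1 (f^[p.2] x') = 0 ∨ c p.1 (f^[p.2] x') = 1)) (fun R hR => hcamb x' R hR)
      fun b hb => ?_
    have hbn : b < n := Finset.mem_range.1 (hS hb)
    by_contra hcon
    apply hbad b hb
    obtain ⟨k, hk, hvisit⟩ := hr (f^[3 * m] (f^[7 * m * b] x))
    set z := (f ^ ((k + 2 * m + 7 * m * b : ℕ) : ℤ)) x with hz
    have hzY : z ∈ Y := by
      refine Metric.ball_subset_closedBall ?_
      convert hvisit using 1
      simp only [hz, zpow_apply_natCast, ← Function.iterate_add_apply]
      congr 1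
      ring
    obtain ⟨i, hi, hci⟩ := hcfull z hzY
    obtain ⟨i', hi', j, hj, hσ⟩ := hσfull z i hi hci (by
      intro i' hi' j hj
      by_contra hamb
      apply hcon
      have hj' := abs_le.1 hj
      push_cast at hj'
      obtain ⟨w, hw⟩ : ∃ w : ℕ, (w : ℤ) = (k + 2 * m + 7 * m * b : ℕ) + j + 2 * q * m := by
        refine ⟨((k + 2 * m + 7 * m * b : ℕ) + j + 2 * q * m : ℤ).toNat, Int.toNat_of_nonneg ?_⟩
        push_cast
        nlinarith
      have hlow : 7 * m * b + 2 * m ≤ w := by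
        zify
        rw [hw]
        push_cast
        linarith
      have hkm : k ≤ m := by omega
      have hupp : w ≤ 7 * m * b + 3 * m + 4 * q * m := by
        zify at hkm ⊢
        rw [hw]
        push_cast
        linarith
      refine ⟨(i', w), ⟨hi', hupp.trans ?_, ?_⟩, hlow, hupp⟩
      · rw [hT]
        gcongr
      · have hwx : f^[w] x' = (f ^ j) z := by
          rw [← zpow_apply_natCast, hw, hz, ← zpow_apply_add, ← zpow_apply_add]
          congr 2
          ring
        rw [hwx]
        exact hamb)
    have hj' := abs_lt.1 hj
    refine ⟨((k + 2 * m : ℕ) + j : ℤ).toNat, by omega, i', hi', ?_⟩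
    convert hσ using 2
    rw [hz, ← zpow_apply_natCast, ← zpow_apply_natCast, ← zpow_apply_add, ← zpow_apply_add,
      Int.toNat_of_nonneg (by omega)]
    congr 2
    push_cast
    ring

/-! ### Minimal homeomorphisms with a periodic point -/

lemma exists_iterate_eq_of_periodic {f : K ≃ₜ K} {x : K}
    (hmin : Dense (Set.range fun n : ℤ => (f ^ n) x)) {N : ℕ} (hN : 0 < N) (hx : f^[N] x = x)
    (z : K) : ∃ j < N, f^[j] x = z := by
  have hfin : ((fun j : ℕ => f^[j] x) '' Set.Iio N).Finite := (Set.finite_Iio N).image _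
  have hsub : Set.range (fun n : ℤ => (f ^ n) x) ⊆ (fun j : ℕ => f^[j] x) '' Set.Iio N := by
    rintro _ ⟨n, rfl⟩
    have hN' : (0 : ℤ) < N := by exact_mod_cast hN
    have h0 := Int.emod_nonneg n hN'.ne'
    have h1 := Int.emod_lt_of_pos n hN'
    refine ⟨(n % N).toNat, by simp only [Set.mem_Iio]; omega, ?_⟩
    have hfix : ∀ k : ℤ, (f ^ (N * k : ℤ)) x = x := by
      intro k
      have hx' : (f ^ (N : ℤ)) x = x := by rw [zpow_apply_natCast, hx]
      have hmul : Function.IsFixedPt ((f ^ (N : ℤ)).toEquiv) x := hx'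
      have := hmul.perm_zpow k
      have h2 : ((f ^ (N : ℤ)).toEquiv ^ k) x = x := this
      rwa [toEquiv_zpow_apply, ← zpow_mul] at h2
    beta_reduce
    rw [← zpow_apply_natCast, Int.toNat_of_nonneg h0]
    conv_rhs => rw [← Int.emod_add_mul_ediv n N, zpow_apply_add, hfix]
  have huniv : (fun j : ℕ => f^[j] x) '' Set.Iio N = Set.univ := by
    rw [← hfin.isClosed.closure_eq]
    exact (hmin.mono hsub).closure_eq
  exact (huniv ▸ Set.mem_univ z : z ∈ (fun j : ℕ => f^[j] x) '' Set.Iio N)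

lemma norm_inv_cocycle_le_pow (f : K ≃ₜ K) {A : C(K, SL2)} {C : ℝ}
    (hC : ∀ x, ‖(((A x)⁻¹ : SL2) : M2)‖ ≤ C) (n : ℕ) (x : K) :
    ‖(((cocycle f A n x)⁻¹ : SL2) : M2)‖ ≤ C ^ n := by
  induction n generalizing x with
  | zero => simp [cocycle]
  | succ n ih =>
    rw [cocycle, mul_inv_rev, Matrix.SpecialLinearGroup.coe_mul, pow_succ']
    exact (norm_mul_le _ _).trans
      (mul_le_mul (hC x) (ih (f x)) (norm_nonneg _) ((norm_nonneg _).trans (hC x)))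

/-- Over a periodic orbit, positive growth rate implies uniform hyperbolicity. -/
lemma unifHyp_of_periodic {f : K ≃ₜ K}
    (hmin : ∀ x, Dense (Set.range fun n : ℤ => (f ^ n) x)) {x : K} {N : ℕ} (hN : 0 < N)
    (hx : f^[N] x = x) {A : C(K, SL2)} {μ : ℝ} (hμ : 0 < μ) (hA : A ∉ growthBelow f μ) :
    UnifHyp f A := by
  have hper : ∀ z, f^[N] z = z := by
    intro z
    obtain ⟨j, -, rfl⟩ := exists_iterate_eq_of_periodic (hmin x) hN hx z
    rw [← Function.iterate_add_apply, add_comm, Function.iterate_add_apply, hx]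
  obtain ⟨C, hC1, hC⟩ := exists_norm_bound A
  obtain ⟨M, hM⟩ := exists_const_le_exp (C ^ N * C ^ N) (half_pos hμ)
  refine ⟨μ / 2, half_pos hμ, M + 1, fun z n hn => ?_⟩
  rw [sl2Norm_eq]
  simp only [growthBelow, Set.mem_ofPred_eq, not_exists, not_and, not_forall, not_lt] at hA
  obtain ⟨y, hy⟩ := hA n (by omega)
  obtain ⟨j, hj, rfl⟩ := exists_iterate_eq_of_periodic (hmin z) hN (hper z) y
  have hcomm : cocycle f A n (f^[j] z) =
      cocycle f A j (f^[n] z) * cocycle f A n z * (cocycle f A j z)⁻¹ := by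
    rw [eq_mul_inv_iff_mul_eq, ← cocycle_add, ← cocycle_add, add_comm]
  have hpow : ∀ w, ‖(cocycle f A j w : M2)‖ ≤ C ^ N := fun w =>
    (norm_cocycle_le_pow f (fun x => (hC x).1) j w).trans (pow_le_pow_right₀ hC1 hj.le)
  have hle : Real.exp (μ * n) ≤ C ^ N * C ^ N * ‖(cocycle f A n z : M2)‖ := by
    refine hy.trans ?_
    rw [hcomm, Matrix.SpecialLinearGroup.coe_mul, Matrix.SpecialLinearGroup.coe_mul]
    calc _ ≤ _ := norm_mul_le _ _
      _ ≤ C ^ N * ‖(cocycle f A n z : M2)‖ * C ^ N := by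
        gcongr
        · refine (norm_mul_le _ _).trans ?_
          gcongr
          exact hpow _
        · exact (norm_inv_cocycle_le_pow f (fun x => (hC x).2) j z).trans
            (pow_le_pow_right₀ hC1 hj.le)
      _ = _ := by ring
  have hexp : Real.exp (μ * n) = Real.exp (μ / 2 * n) * Real.exp (μ / 2 * n) := by
    rw [← Real.exp_add]; ring_nf
  rw [hexp] at hle
  refine le_of_mul_le_mul_left (hle.trans ?_) (Real.exp_pos (μ / 2 * n))
  gcongr
  exact hM n (by omega)

/-! ### The Baire category argument -/

lemma baireSpace_continuousMap_SL2 : BaireSpace C(K, SL2) := by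
  let g : C(SL2, M2) := ⟨fun M => (M : M2), continuous_coe_SL2⟩
  have hg : IsEmbedding g := ⟨isInducing_coe_SL2, Subtype.coe_injective⟩
  have hemb : IsClosedEmbedding (g.comp : C(K, SL2) → C(K, M2)) := by
    refine ⟨g.isEmbedding_postcomp hg, ?_⟩
    have hrange : Set.range (g.comp : C(K, SL2) → C(K, M2)) =
        ⋂ x : K, {F : C(K, M2) | (F x).det = 1} := by
      ext F
      simp only [Set.mem_range, Set.mem_iInter, Set.mem_ofPred_eq]
      constructor
      · rintro ⟨B, rfl⟩ x
        exact (B x).det_coe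
      · intro h
        refine ⟨⟨fun x => ⟨F x, h x⟩, isInducing_coe_SL2.continuous_iff.2 F.continuous⟩, ?_⟩
        ext1 x
        rfl
    rw [hrange]
    refine isClosed_iInter fun x => isClosed_eq ?_ continuous_const
    exact (Continuous.matrix_det continuous_id).comp (continuous_eval_const x)
  have := hemb.IsCompletelyMetrizableSpace
  infer_instance

lemma dense_union_compl_closure {X : Type*} [TopologicalSpace X] (O : Set X) :
    Dense (O ∪ (closure O)ᶜ) := by
  rw [dense_iff_closure_eq, closure_union, Set.eq_univ_iff_forall]
  intro x
  by_cases hx : x ∈ closure O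
  · exact Or.inl hx
  · exact Or.inr (subset_closure hx)

lemma unifHyp_or_unifSubexp {f : K ≃ₜ K}
    (hmin : ∀ x, Dense (Set.range fun n : ℤ => (f ^ n) x)) {d : ℕ}
    {s : K → EuclideanSpace ℝ (Fin d)} (hs : IsEmbedding s) {A : C(K, SL2)}
    (hA : ∀ q : ℚ, A ∈ growthBelow f q ∪ (closure (growthBelow f q))ᶜ) :
    UnifHyp f A ∨ UnifSubexp f A := by
  by_contra! hcon
  obtain ⟨hhyp, hsub⟩ := hcon
  obtain ⟨μ₀, hμ₀, hAμ₀⟩ : ∃ μ₀ > 0, A ∉ growthBelow f μ₀ := by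
    by_contra! h
    exact hsub (unifSubexp_of_growthBelow f h)
  have hper : ∀ x, ∀ n : ℕ, 0 < n → f^[n] x ≠ x := fun x n hn hx =>
    hhyp (unifHyp_of_periodic hmin hn hx hμ₀ hAμ₀)
  set S := {μ : ℝ | A ∈ growthBelow f μ} with hS
  have hlow : ∀ μ ∈ S, μ₀ ≤ μ := fun μ hμ => by
    by_contra! h
    exact hAμ₀ (growthBelow_mono f h.le hμ)
  obtain ⟨μ₁, -, hμ₁⟩ := exists_mem_growthBelow f A
  have hrate : μ₀ ≤ sInf S := le_csInf ⟨μ₁, hμ₁⟩ hlow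
  obtain ⟨μ, hμS, hμ⟩ := exists_lt_of_csInf_lt (s := S) ⟨μ₁, hμ₁⟩
    (show sInf S < 28 / 27 * sInf S by linarith)
  obtain ⟨q, hq, hq'⟩ := exists_rat_btwn (show 27 / 28 * μ < sInf S by linarith)
  have hclosure := mem_closure_growthBelow hmin hper hs hhyp (hμ₀.trans_le (hlow μ hμS)) hμS
  rcases hA q with h | h
  · exact hq'.not_ge (csInf_le ⟨μ₀, hlow⟩ h)
  · exact h (closure_mono (growthBelow_mono f hq.le) hclosure)

end Dichotomy

/-- A uniform dichotomy for generic SL(2,ℝ) cocycles over a minimal base. -/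
theorem stmt_0 {K : Type*} [MetricSpace K] [CompactSpace K]
    (hfd : ∃ n : ℕ, ∃ s : K → EuclideanSpace ℝ (Fin n), Topology.IsEmbedding s)
    (f : K ≃ₜ K)
    (hmin : ∀ x : K, Dense (Set.range fun n : ℤ => (f.toEquiv ^ n) x)) :
    ∃ R : Set C(K, Matrix.SpecialLinearGroup (Fin 2) ℝ),
      IsGδ R ∧ Dense R ∧
      ∀ A ∈ R, UnifHyp (⇑f) (⇑A) ∨ UnifSubexp (⇑f) (⇑A) := by
  have hmin' : ∀ x, Dense (Set.range fun n : ℤ => (f ^ n) x) := by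
    intro x
    simpa only [toEquiv_zpow_apply] using hmin x
  have := baireSpace_continuousMap_SL2 (K := K)
  have hopen : ∀ q : ℚ, IsOpen (growthBelow f q ∪ (closure (growthBelow f q))ᶜ) := fun q =>
    (isOpen_growthBelow f q).union isClosed_closure.isOpen_compl
  obtain ⟨d, s, hs⟩ := hfd
  exact ⟨⋂ q : ℚ, growthBelow f q ∪ (closure (growthBelow f q))ᶜ,
    .iInter_of_isOpen hopen,
    dense_iInter_of_isOpen hopen fun q => dense_union_compl_closure _,
    fun A hA => unifHyp_or_unifSubexp hmin' hs (Set.mem_iInter.1 hA)⟩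
end

section
/- Let f : K → K be a minimal homeomorphism with no periodic orbits of a compact metric space K, and let A : K → SL(2,ℝ) be continuous. Assume that (f,A) is not uniformly hyperbolic but that there exists an f-invariant Borel probability measure μ with L(f,A,μ) > 0. Then for every ε>0 there exist a non-empty open set W ⊂ K and m ∈ ℕ such that: (i) W, f(W), …, f^{m−1}(W) are pairwise disjoint; and (ii) for every x ∈ W and all non-zero vectors v, w ∈ ℝ², there exist matrices M_0, …, M_{m−1} ∈ SL(2,ℝ) with ‖M_j − A(f^j(x))‖ < ε for each 0 ≤ j ≤ m−1 and such that M_{m−1}···M_0(v) is collinear to w. -/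
open MeasureTheory Filter Topology

namespace RealignDirections

open Matrix

/-- Determinant of a pair of plane vectors. -/
def det2 (v w : Fin 2 → ℝ) : ℝ := v 0 * w 1 - v 1 * w 0

/-- Square of the euclidean norm of a plane vector. -/
def normSq (v : Fin 2 → ℝ) : ℝ := v 0 ^ 2 + v 1 ^ 2

lemma normSq_nonneg (v : Fin 2 → ℝ) : 0 ≤ normSq v := by
  unfold normSq; positivity

lemma normSq_pos {v : Fin 2 → ℝ} (hv : v ≠ 0) : 0 < normSq v := by
  refine lt_of_le_of_ne (normSq_nonneg v) fun h => hv ?_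
  unfold normSq at h
  have h0 : v 0 = 0 := by nlinarith [sq_nonneg (v 0), sq_nonneg (v 1)]
  have h1 : v 1 = 0 := by nlinarith [sq_nonneg (v 0), sq_nonneg (v 1)]
  ext i
  fin_cases i <;> simpa

lemma det2_sq_le (v w : Fin 2 → ℝ) : det2 v w ^ 2 ≤ normSq v * normSq w := by
  unfold det2 normSq
  nlinarith [sq_nonneg (v 0 * w 0 + v 1 * w 1)]

lemma det2_mulVec (M : Matrix.SpecialLinearGroup (Fin 2) ℝ) (v w : Fin 2 → ℝ) :
    det2 ((M : Matrix (Fin 2) (Fin 2) ℝ) *ᵥ v) ((M : Matrix (Fin 2) (Fin 2) ℝ) *ᵥ w)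
      = det2 v w := by
  have h := M.det_coe
  rw [Matrix.det_fin_two] at h
  simp only [det2, Matrix.mulVec, dotProduct, Fin.sum_univ_two]
  linear_combination (v 0 * w 1 - v 1 * w 0) * h

lemma mulVec_ne_zero (M : Matrix.SpecialLinearGroup (Fin 2) ℝ) {v : Fin 2 → ℝ} (hv : v ≠ 0) :
    (M : Matrix (Fin 2) (Fin 2) ℝ) *ᵥ v ≠ 0 := by
  intro h
  apply hv
  have : ((M⁻¹ * M : Matrix.SpecialLinearGroup (Fin 2) ℝ) : Matrix (Fin 2) (Fin 2) ℝ) *ᵥ v = 0 := by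
    rw [Matrix.SpecialLinearGroup.coe_mul, ← mulVec_mulVec, h, mulVec_zero]
  rwa [inv_mul_cancel, Matrix.SpecialLinearGroup.coe_one, one_mulVec] at this

lemma norm_toLp_sq (v : Fin 2 → ℝ) : ‖(WithLp.toLp 2 v : EuclideanSpace ℝ (Fin 2))‖ ^ 2
    = normSq v := by
  simp [EuclideanSpace.norm_sq_eq, normSq]

lemma matOpNorm_nonneg (M : Matrix (Fin 2) (Fin 2) ℝ) : 0 ≤ matOpNorm M := norm_nonneg _

lemma normSq_mulVec_le (M : Matrix (Fin 2) (Fin 2) ℝ) (v : Fin 2 → ℝ) :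
    normSq (M *ᵥ v) ≤ matOpNorm M ^ 2 * normSq v := by
  have h := (Matrix.toEuclideanCLM (𝕜 := ℝ) M).le_opNorm (WithLp.toLp 2 v)
  rw [Matrix.toEuclideanCLM_toLp] at h
  rw [← norm_toLp_sq, ← norm_toLp_sq, ← mul_pow]
  exact pow_le_pow_left₀ (norm_nonneg _) h 2

lemma matOpNorm_le (M : Matrix (Fin 2) (Fin 2) ℝ) {C : ℝ} (hC : 0 ≤ C)
    (h : ∀ v, normSq (M *ᵥ v) ≤ C ^ 2 * normSq v) : matOpNorm M ≤ C := by
  refine ContinuousLinearMap.opNorm_le_bound _ hC fun v => ?_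
  have h' := h v.ofLp
  rw [← norm_toLp_sq, ← norm_toLp_sq, ← mul_pow] at h'
  have h2 := le_of_sq_le_sq h' (by positivity)
  rwa [← Matrix.toEuclideanCLM_toLp] at h2

lemma matOpNorm_mul_le (M N : Matrix (Fin 2) (Fin 2) ℝ) :
    matOpNorm (M * N) ≤ matOpNorm M * matOpNorm N := by
  unfold matOpNorm
  rw [map_mul]
  exact norm_mul_le _ _

lemma matOpNorm_add_le (M N : Matrix (Fin 2) (Fin 2) ℝ) :
    matOpNorm (M + N) ≤ matOpNorm M + matOpNorm N := by
  unfold matOpNorm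
  rw [map_add]
  exact norm_add_le _ _

lemma continuous_matOpNorm : Continuous matOpNorm := by
  have : Continuous (Matrix.toEuclideanCLM (n := Fin 2) (𝕜 := ℝ)) :=
    LinearMap.continuous_of_finiteDimensional
      (Matrix.toEuclideanCLM (n := Fin 2) (𝕜 := ℝ)).toAlgEquiv.toLinearMap
  exact this.norm

/-- A matrix of determinant one contracts no vector by more than its operator norm. -/
lemma normSq_le_sl2Norm_sq_mul (M : Matrix.SpecialLinearGroup (Fin 2) ℝ) (w : Fin 2 → ℝ) :
    normSq w ≤ sl2Norm M ^ 2 * normSq ((M : Matrix (Fin 2) (Fin 2) ℝ) *ᵥ w) := by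
  rcases eq_or_ne w 0 with rfl | hw
  · simp [normSq]
  have hpos := normSq_pos hw
  let p : Fin 2 → ℝ := ![-w 1, w 0]
  have hp : normSq p = normSq w := by simp [p, normSq]; ring
  have hd : det2 w p = normSq w := by simp [p, det2, normSq]; ring
  have h1 := det2_sq_le ((M : Matrix (Fin 2) (Fin 2) ℝ) *ᵥ w)
    ((M : Matrix (Fin 2) (Fin 2) ℝ) *ᵥ p)
  rw [det2_mulVec, hd] at h1
  have h2 := normSq_mulVec_le (M : Matrix (Fin 2) (Fin 2) ℝ) p
  rw [hp] at h2
  have h3 := mul_le_mul_of_nonneg_left h2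
    (normSq_nonneg ((M : Matrix (Fin 2) (Fin 2) ℝ) *ᵥ w))
  refine le_of_mul_le_mul_right ?_ hpos
  unfold sl2Norm
  linarith

/-- The shear `u ↦ u + t det(w, u) w`, which fixes `w`. -/
def shear (w : Fin 2 → ℝ) (t : ℝ) : Matrix.SpecialLinearGroup (Fin 2) ℝ :=
  ⟨!![1 - t * w 1 * w 0, t * w 0 * w 0; -t * w 1 * w 1, 1 + t * w 0 * w 1], by
    rw [Matrix.det_fin_two_of]; ring⟩

lemma shear_mulVec (w : Fin 2 → ℝ) (t : ℝ) (u : Fin 2 → ℝ) :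
    (shear w t : Matrix (Fin 2) (Fin 2) ℝ) *ᵥ u = u + (t * det2 w u) • w := by
  ext i
  fin_cases i <;> simp [shear, det2, Matrix.mulVec, dotProduct, Fin.sum_univ_two] <;> ring

lemma matOpNorm_shear_sub_one_le (w : Fin 2 → ℝ) (t : ℝ) :
    matOpNorm ((shear w t : Matrix (Fin 2) (Fin 2) ℝ) - 1) ≤ |t| * normSq w := by
  refine matOpNorm_le _ (mul_nonneg (abs_nonneg _) (normSq_nonneg _)) fun u => ?_
  rw [Matrix.sub_mulVec, shear_mulVec, Matrix.one_mulVec, add_sub_cancel_left]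
  have h : normSq ((t * det2 w u) • w) = t ^ 2 * normSq w * det2 w u ^ 2 := by
    simp [normSq]; ring
  rw [h, mul_pow, sq_abs]
  have := mul_le_mul_of_nonneg_left (det2_sq_le w u)
    (mul_nonneg (sq_nonneg t) (normSq_nonneg w))
  linarith

/-- Two directions making a small angle are aligned by a shear close to the identity. -/
lemma exists_align {u w : Fin 2 → ℝ} {δ : ℝ} (hu : u ≠ 0)
    (hi : u 0 * w 0 + u 1 * w 1 ≠ 0) (h : |det2 u w| ≤ δ * |u 0 * w 0 + u 1 * w 1|) :
    ∃ T : Matrix.SpecialLinearGroup (Fin 2) ℝ, matOpNorm ((T : Matrix (Fin 2) (Fin 2) ℝ) - 1) ≤ δ ∧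
      ∃ c : ℝ, c ≠ 0 ∧ (T : Matrix (Fin 2) (Fin 2) ℝ) *ᵥ u = c • w := by
  have hpos := normSq_pos hu
  set I := u 0 * w 0 + u 1 * w 1 with hI
  let p : Fin 2 → ℝ := ![-u 1, u 0]
  have hp : normSq p = normSq u := by simp [p, normSq]; ring
  have hpu : det2 p u = -normSq u := by simp [p, det2, normSq]; ring
  refine ⟨shear p (-(det2 u w / (normSq u * I))), ?_, normSq u / I,
    div_ne_zero hpos.ne' hi, ?_⟩
  · refine (matOpNorm_shear_sub_one_le _ _).trans ?_
    rw [hp, abs_neg, abs_div, abs_mul, abs_of_pos hpos]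
    have : 0 < |I| := abs_pos.mpr hi
    rw [div_mul_eq_mul_div, div_le_iff₀ (by positivity)]
    nlinarith
  · rw [shear_mulVec, hpu]
    have hne := hpos.ne'
    have e : -(det2 u w / (normSq u * I)) * -normSq u = det2 u w / I := by
      field_simp
    rw [e]
    ext i
    fin_cases i <;> simp [p] <;> field_simp <;> simp only [hI, det2, normSq] <;> ring

/-- The partial products `M (n - 1) ⋯ M 1 M 0`. -/
def seqProd (M : ℕ → Matrix.SpecialLinearGroup (Fin 2) ℝ) : ℕ → Matrix.SpecialLinearGroup (Fin 2) ℝ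
  | 0 => 1
  | n + 1 => M n * seqProd M n

lemma seqProd_eq_ofFn (M : ℕ → Matrix.SpecialLinearGroup (Fin 2) ℝ) (n : ℕ) :
    (List.ofFn fun j : Fin n => M j).reverse.prod = seqProd M n := by
  induction n with
  | zero => simp [seqProd]
  | succ n ih =>
    rw [List.ofFn_succ', List.concat_eq_append, List.reverse_append]
    simp only [Fin.val_castSucc, Fin.val_last, List.reverse_singleton, List.singleton_append,
      List.prod_cons, ih, seqProd]

lemma cocycle_succ' {K : Type*} (f : K → K) (A : K → Matrix.SpecialLinearGroup (Fin 2) ℝ) (n : ℕ) (x : K) :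
    cocycle f A (n + 1) x = A (f^[n] x) * cocycle f A n x := by
  induction n generalizing x with
  | zero => simp [cocycle]
  | succ n ih =>
    rw [cocycle, ih (f x), mul_assoc, ← cocycle, Function.iterate_succ_apply]

lemma cocycle_eq_seqProd {K : Type*} (f : K → K) (A : K → Matrix.SpecialLinearGroup (Fin 2) ℝ) (n : ℕ) (x : K) :
    cocycle f A n x = seqProd (fun k => A (f^[k] x)) n := by
  induction n with
  | zero => rfl
  | succ n ih => rw [cocycle_succ', ih, seqProd]

/-- Some `δ`-perturbation `B k * T k` of the matrices `B k`, `k < m`, sends the direction of `v`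
to the direction of `w`. -/
def Realignable (B : ℕ → Matrix.SpecialLinearGroup (Fin 2) ℝ) (δ : ℝ) (m : ℕ) (v w : Fin 2 → ℝ) : Prop :=
  ∃ T : ℕ → Matrix.SpecialLinearGroup (Fin 2) ℝ, (∀ k, matOpNorm ((T k : Matrix (Fin 2) (Fin 2) ℝ) - 1) ≤ δ) ∧
    ∃ c : ℝ, c ≠ 0 ∧
      (seqProd (fun k => B k * T k) m : Matrix (Fin 2) (Fin 2) ℝ) *ᵥ v = c • w

lemma seqProd_succ_mulVec (M : ℕ → Matrix.SpecialLinearGroup (Fin 2) ℝ) (n : ℕ) (v : Fin 2 → ℝ) :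
    (seqProd M (n + 1) : Matrix (Fin 2) (Fin 2) ℝ) *ᵥ v
      = (M n : Matrix (Fin 2) (Fin 2) ℝ) *ᵥ
        ((seqProd M n : Matrix (Fin 2) (Fin 2) ℝ) *ᵥ v) := by
  rw [seqProd, Matrix.SpecialLinearGroup.coe_mul, mulVec_mulVec]

/-- Shears along the orbit of `w` add up. -/
lemma seqProd_shear_mulVec (B T : ℕ → Matrix.SpecialLinearGroup (Fin 2) ℝ) (v w : Fin 2 → ℝ) (t : ℕ → ℝ) (j : ℕ)
    (hT : ∀ k < j, T k = shear ((seqProd B k : Matrix (Fin 2) (Fin 2) ℝ) *ᵥ w) (t k)) :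
    (seqProd (fun k => B k * T k) j : Matrix (Fin 2) (Fin 2) ℝ) *ᵥ v
      = (seqProd B j : Matrix (Fin 2) (Fin 2) ℝ) *ᵥ
        (v + ((∑ k ∈ Finset.range j, t k) * det2 w v) • w) := by
  induction j with
  | zero => simp [seqProd]
  | succ j ih =>
    rw [seqProd_succ_mulVec, seqProd_succ_mulVec, ih fun k hk => hT k (by omega),
      Matrix.SpecialLinearGroup.coe_mul,
      ← mulVec_mulVec, hT j (by omega), shear_mulVec, det2_mulVec,
      Finset.sum_range_succ, ← mulVec_smul, ← mulVec_add]
    congr 2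
    have : det2 w (v + ((∑ k ∈ Finset.range j, t k) * det2 w v) • w) = det2 w v := by
      simp [det2]; ring
    rw [this, add_assoc, ← add_smul]
    ring_nf

/-- If a direction cannot be realigned with another one, then the orbit of the target direction
is contracted at a definite rate. -/
lemma sum_inv_normSq_le_of_not_realignable (B : ℕ → Matrix.SpecialLinearGroup (Fin 2) ℝ) {δ : ℝ} (hδ : 0 < δ) {m : ℕ}
    {v w : Fin 2 → ℝ} (hv : v ≠ 0) (hw : w ≠ 0)
    (h : ¬ Realignable B δ m v ((seqProd B m : Matrix (Fin 2) (Fin 2) ℝ) *ᵥ w))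
    {j : ℕ} (hj : j < m) :
    δ ^ 2 * ∑ k ∈ Finset.range j, (normSq ((seqProd B k : Matrix (Fin 2) (Fin 2) ℝ) *ᵥ w))⁻¹
      ≤ (normSq ((seqProd B j : Matrix (Fin 2) (Fin 2) ℝ) *ᵥ w))⁻¹ := by
  by_contra! hlt
  apply h
  set y : ℕ → Fin 2 → ℝ := fun k => (seqProd B k : Matrix (Fin 2) (Fin 2) ℝ) *ᵥ w with hy
  have hypos : ∀ k, 0 < normSq (y k) := fun k => normSq_pos (mulVec_ne_zero _ hw)
  set z := (seqProd B j : Matrix (Fin 2) (Fin 2) ℝ) *ᵥ v with hz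
  set S := ∑ k ∈ Finset.range j, (normSq (y k))⁻¹ with hS
  have hyj : 0 < normSq (y j) := hypos j
  have hSpos : 0 < S := by
    have : 0 < δ ^ 2 * S := lt_trans (inv_pos.mpr hyj) hlt
    exact pos_of_mul_pos_right this (by positivity)
  set D := det2 w v with hD
  set I := z 0 * y j 0 + z 1 * y j 1 with hI
  have hzy : det2 (y j) z = D := det2_mulVec _ _ _
  obtain ⟨σ, hσ, hσI⟩ : ∃ σ : ℝ, |σ| = 1 ∧ 0 ≤ σ * D * I := by
    rcases le_total 0 (D * I) with h0 | h0
    · exact ⟨1, by simp, by linarith⟩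
    · exact ⟨-1, by simp, by linarith⟩
  set s := σ * δ * S * D with hs
  set u := z + s • y j with hu
  have hdet : det2 u (y j) = -D := by
    rw [← hzy, hu]; simp [det2]; ring
  have hinner : u 0 * y j 0 + u 1 * y j 1 = I + s * normSq (y j) := by
    simp [hu, hI, normSq]; ring
  have hsq : (s * normSq (y j)) ^ 2 + I ^ 2 ≤ (I + s * normSq (y j)) ^ 2 := by
    have : 0 ≤ (σ * D * I) * (δ * S * normSq (y j)) := by positivity
    have e : (I + s * normSq (y j)) ^ 2 = (s * normSq (y j)) ^ 2 + I ^ 2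
        + 2 * ((σ * D * I) * (δ * S * normSq (y j))) := by rw [hs]; ring
    linarith
  have hbig : 1 < δ ^ 2 * S * normSq (y j) := by
    rw [inv_lt_iff_one_lt_mul₀ hyj] at hlt
    linarith
  have hbound : |det2 u (y j)| ≤ δ * |u 0 * y j 0 + u 1 * y j 1| := by
    rw [hdet, hinner, abs_neg]
    have h1 : |s * normSq (y j)| ≤ |I + s * normSq (y j)| :=
      sq_le_sq.mp (by nlinarith [sq_nonneg I])
    have h2 : δ * |s * normSq (y j)| = (δ ^ 2 * S * normSq (y j)) * |D| := by
      rw [hs]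
      simp only [abs_mul, hσ, abs_of_pos hδ, abs_of_pos hSpos, abs_of_pos hyj]
      ring
    nlinarith [abs_nonneg D]
  have hz0 : z ≠ 0 := mulVec_ne_zero _ hv
  have hne : u 0 * y j 0 + u 1 * y j 1 ≠ 0 := by
    intro h0
    have hD0 : D = 0 := by
      rw [h0, abs_zero, mul_zero, hdet, abs_neg] at hbound
      exact abs_nonpos_iff.mp hbound
    have hI0 : I = 0 := by
      rw [← hinner, h0] at hsq
      nlinarith [sq_nonneg (s * normSq (y j)), sq_nonneg I]
    have : normSq z * normSq (y j) = I ^ 2 + det2 (y j) z ^ 2 := by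
      simp only [hI, normSq, det2]; ring
    rw [hI0, hzy, hD0] at this
    have := mul_pos (normSq_pos hz0) hyj
    nlinarith
  have hu0 : u ≠ 0 := by
    intro h0
    rw [h0] at hne
    simp at hne
  obtain ⟨R, hR, c, hc, hRc⟩ := exists_align hu0 hne hbound
  let t : ℕ → ℝ := fun k => σ * δ * (normSq (y k))⁻¹
  let T : ℕ → Matrix.SpecialLinearGroup (Fin 2) ℝ := fun k => if k < j then shear (y k) (t k) else if k = j then R else 1
  refine ⟨T, fun k => ?_, c, hc, ?_⟩
  · by_cases h1 : k < j
    · simp only [T, h1, if_true]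
      refine (matOpNorm_shear_sub_one_le _ _).trans (le_of_eq ?_)
      have := hypos k
      simp only [t, abs_mul, hσ, abs_of_pos hδ, abs_inv, abs_of_pos this]
      field_simp
    · by_cases h2 : k = j
      · simpa [T, h2] using hR
      · simp [T, h1, h2, matOpNorm, hδ.le]
  · have hstart : (seqProd (fun k => B k * T k) j : Matrix (Fin 2) (Fin 2) ℝ) *ᵥ v = u := by
      rw [seqProd_shear_mulVec B T v w t j (fun k hk => if_pos hk), mulVec_add,
        mulVec_smul]
      simp only [hu, hs, t, ← Finset.mul_sum, hS, hz, hy, hD]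
    have hrest : ∀ i, (seqProd (fun k => B k * T k) (j + 1 + i) : Matrix (Fin 2) (Fin 2) ℝ) *ᵥ v
        = c • y (j + 1 + i) := by
      intro i
      induction i with
      | zero =>
        rw [add_zero, seqProd_succ_mulVec, hstart, Matrix.SpecialLinearGroup.coe_mul,
          ← mulVec_mulVec]
        simp only [T, lt_irrefl, if_false, if_true]
        rw [hRc, mulVec_smul, hy]
        simp only [seqProd_succ_mulVec]
      | succ i ih =>
        have h1 : ¬ j + 1 + i < j := by omega
        have h2 : j + 1 + i ≠ j := by omega
        rw [← add_assoc, seqProd_succ_mulVec, ih]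
        simp only [T, h1, h2, if_false, mul_one]
        rw [mulVec_smul, hy]
        simp only [seqProd_succ_mulVec]
    have := hrest (m - (j + 1))
    rwa [Nat.add_sub_cancel' (by omega)] at this

/-- A positive sequence dominating its partial sums grows exponentially. -/
lemma exp_growth_of_sum_le {a : ℕ → ℝ} {κ : ℝ} (hκ : 0 < κ) {n : ℕ}
    (h : ∀ j ≤ n, κ * ∑ k ∈ Finset.range j, a k ≤ a j) :
    κ * (1 + κ) ^ n * a 0 ≤ (1 + κ) * a n := by
  have key : ∀ j ≤ n, (1 + κ) ^ j * a 0 ≤ ∑ k ∈ Finset.range (j + 1), a k := by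
    intro j
    induction j with
    | zero => simp
    | succ j ih =>
      intro hj
      have h1 := ih (by omega)
      have h2 := h (j + 1) hj
      rw [Finset.sum_range_succ, pow_succ]
      nlinarith
  have h1 := key n le_rfl
  have h2 := h n le_rfl
  rw [Finset.sum_range_succ] at h1
  nlinarith

lemma sl2Norm_sq_ge_of_not_realignable (B : ℕ → Matrix.SpecialLinearGroup (Fin 2) ℝ) {δ : ℝ} (hδ : 0 < δ) {n : ℕ}
    {v w : Fin 2 → ℝ} (hv : v ≠ 0) (hw : w ≠ 0) (h : ¬ Realignable B δ (n + 1) v w) :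
    δ ^ 2 * (1 + δ ^ 2) ^ n ≤ (1 + δ ^ 2) * sl2Norm (seqProd B n) ^ 2 := by
  obtain ⟨w, rfl⟩ : ∃ w', (seqProd B (n + 1) : Matrix (Fin 2) (Fin 2) ℝ) *ᵥ w' = w :=
    ⟨((seqProd B (n + 1))⁻¹ : Matrix.SpecialLinearGroup (Fin 2) ℝ) *ᵥ w, by
      rw [mulVec_mulVec, ← Matrix.SpecialLinearGroup.coe_mul, mul_inv_cancel,
        Matrix.SpecialLinearGroup.coe_one, one_mulVec]⟩
  have hw' : w ≠ 0 := by
    rintro rfl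
    simp at hw
  have hgrow := exp_growth_of_sum_le (n := n) (pow_pos hδ 2) fun j hj =>
    sum_inv_normSq_le_of_not_realignable B hδ hv hw' h (j := j) (by omega)
  have hnorm := normSq_le_sl2Norm_sq_mul (seqProd B n) w
  have hn := normSq_pos (mulVec_ne_zero (seqProd B n) hw')
  have h0 := normSq_pos hw'
  simp only [seqProd, Matrix.SpecialLinearGroup.coe_one, one_mulVec] at hgrow
  rw [← div_eq_mul_inv, ← div_eq_mul_inv, div_le_div_iff₀ h0 hn] at hgrow
  refine le_of_mul_le_mul_right (hgrow.trans ?_) hn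
  rw [mul_assoc]
  exact mul_le_mul_of_nonneg_left hnorm (by positivity)

/-- A cocycle that is not uniformly hyperbolic has an orbit segment along which all pairs of
directions can be realigned. -/
lemma exists_realignable {K : Type*} (f : K → K) (A : K → Matrix.SpecialLinearGroup (Fin 2) ℝ) (hnuh : ¬ UnifHyp f A)
    {δ : ℝ} (hδ : 0 < δ) :
    ∃ (x : K) (n : ℕ), ∀ v w : Fin 2 → ℝ, v ≠ 0 → w ≠ 0 →
      Realignable (fun k => A (f^[k] x)) δ (n + 1) v w := by
  by_contra! hcon
  apply hnuh
  have hρ : 1 < 1 + δ ^ 2 := by nlinarith [pow_pos hδ 2]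
  set ρ := 1 + δ ^ 2 with hρdef
  have hlog : 0 < Real.log ρ := Real.log_pos hρ
  obtain ⟨N, hN⟩ := exists_nat_gt (Real.log (ρ / δ ^ 2) / (Real.log ρ / 2))
  refine ⟨Real.log ρ / 4, by positivity, N, fun x n hn => ?_⟩
  obtain ⟨v, w, hv, hw, hvw⟩ := hcon x n
  have hmain := sl2Norm_sq_ge_of_not_realignable _ hδ hv hw hvw
  rw [← cocycle_eq_seqProd f A n x, ← hρdef] at hmain
  have hnn : 0 ≤ sl2Norm (cocycle f A n x) := matOpNorm_nonneg _
  refine le_of_sq_le_sq ?_ hnn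
  have hδ2 : 0 < δ ^ 2 := pow_pos hδ 2
  have hconst : ρ / δ ^ 2 ≤ Real.exp (Real.log ρ / 2 * n) := by
    rw [div_lt_iff₀ (by positivity)] at hN
    have hNn : (N : ℝ) ≤ n := by exact_mod_cast hn
    rw [← Real.log_le_iff_le_exp (by positivity)]
    nlinarith
  have hpow : ρ ^ n = Real.exp (Real.log ρ / 2 * n) * Real.exp (Real.log ρ / 2 * n) := by
    rw [← Real.exp_add, ← Real.rpow_natCast, Real.rpow_def_of_pos (by positivity)]
    ring_nf
  have hsq : Real.exp (Real.log ρ / 4 * n) ^ 2 = Real.exp (Real.log ρ / 2 * n) := by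
    rw [← Real.exp_nat_mul]
    push_cast
    ring_nf
  rw [hsq]
  rw [hpow] at hmain
  rw [div_le_iff₀ hδ2] at hconst
  have hE := Real.exp_pos (Real.log ρ / 2 * n)
  refine le_of_mul_le_mul_left (le_trans ?_ hmain) (by positivity : 0 < ρ)
  nlinarith

/-- The first iterates of a small neighbourhood of a non-periodic point are disjoint. -/
lemma eventually_disjoint_images {K : Type*} [TopologicalSpace K] [T2Space K] {f g : K → K}
    (hf : Continuous f) (hg : Continuous g) {x : K} (hx : f x ≠ g x) :
    ∀ᶠ U in (𝓝 x).smallSets, Disjoint (f '' U) (g '' U) := by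
  obtain ⟨V₁, V₂, h₁, h₂, hx₁, hx₂, hd⟩ := t2_separation hx
  refine eventually_smallSets.mpr ⟨f ⁻¹' V₁ ∩ g ⁻¹' V₂,
    inter_mem (hf.continuousAt.preimage_mem_nhds (h₁.mem_nhds hx₁))
      (hg.continuousAt.preimage_mem_nhds (h₂.mem_nhds hx₂)), fun U hU => ?_⟩
  exact hd.mono (Set.image_subset_iff.mpr fun y hy => (hU hy).1)
    (Set.image_subset_iff.mpr fun y hy => (hU hy).2)

end RealignDirections

open RealignDirections

/-- Perturbations realigning directions along segments of orbits (lemma 3.1). -/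
theorem stmt_3 {K : Type*} [MetricSpace K] [CompactSpace K]
    [MeasurableSpace K] [BorelSpace K]
    (f : K ≃ₜ K)
    (hmin : ∀ x : K, Dense (Set.range fun n : ℤ => (f.toEquiv ^ n) x))
    (hnoper : ∀ x : K, ∀ p : ℕ, 0 < p → (⇑f)^[p] x ≠ x)
    (A : C(K, Matrix.SpecialLinearGroup (Fin 2) ℝ))
    (hnuh : ¬ UnifHyp (⇑f) (⇑A))
    (hpos : ∃ μ : Measure K, IsProbabilityMeasure μ ∧ Measure.map (⇑f) μ = μ ∧
      ∃ L : ℝ, 0 < L ∧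
        Tendsto (fun m : ℕ =>
            (m : ℝ)⁻¹ * ∫ y, Real.log (sl2Norm (cocycle (⇑f) (⇑A) m y)) ∂μ)
          atTop (nhds L))
    (ε : ℝ) (hε : 0 < ε) :
    ∃ (W : Set K) (m : ℕ), W.Nonempty ∧ IsOpen W ∧ 0 < m ∧
      (∀ i j : ℕ, i < j → j < m → Disjoint ((⇑f)^[i] '' W) ((⇑f)^[j] '' W)) ∧
      ∀ x ∈ W, ∀ v w : Fin 2 → ℝ, v ≠ 0 → w ≠ 0 →
        ∃ M : Fin m → Matrix.SpecialLinearGroup (Fin 2) ℝ,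
          (∀ j : Fin m, matOpNorm ((M j : Matrix (Fin 2) (Fin 2) ℝ)
              - (A ((⇑f)^[(j : ℕ)] x) : Matrix (Fin 2) (Fin 2) ℝ)) < ε) ∧
          ∃ c : ℝ, c ≠ 0 ∧
            Matrix.mulVec ((List.ofFn M).reverse.prod : Matrix (Fin 2) (Fin 2) ℝ) v
              = c • w := by
  have hA : Continuous fun x => (A x : Matrix (Fin 2) (Fin 2) ℝ) :=
    continuous_induced_dom.comp A.continuous
  obtain ⟨C, hC⟩ : ∃ C, ∀ x, matOpNorm (A x : Matrix (Fin 2) (Fin 2) ℝ) ≤ C := by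
    obtain ⟨C, hC⟩ := (isCompact_range (continuous_matOpNorm.comp hA)).bddAbove
    exact ⟨C, fun x => hC ⟨x, rfl⟩⟩
  have hδ : 0 < ε / (2 * (|C| + 1)) := by positivity
  obtain ⟨x₀, n, hx₀⟩ := exists_realignable f A hnuh hδ
  have hinj : ∀ i j : ℕ, i < j → (⇑f)^[i] x₀ ≠ (⇑f)^[j] x₀ := by
    intro i j hij h
    obtain ⟨p, rfl⟩ := Nat.exists_eq_add_of_lt hij
    rw [add_assoc, Function.iterate_add_apply] at h
    exact hnoper x₀ (p + 1) (by omega) (f.injective.iterate i h).symm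
  have hdisj : ∀ᶠ U in (𝓝 x₀).smallSets, ∀ j ∈ Finset.range (n + 1), ∀ i ∈ Finset.range j,
      Disjoint ((⇑f)^[i] '' U) ((⇑f)^[j] '' U) := by
    simp only [Filter.eventually_all_finset]
    intro j _ i hi
    exact eventually_disjoint_images (f.continuous.iterate i) (f.continuous.iterate j)
      (hinj i j (Finset.mem_range.mp hi))
  have hclose : ∀ᶠ x in 𝓝 x₀, ∀ k ∈ Finset.range (n + 1),
      matOpNorm ((A ((⇑f)^[k] x₀) : Matrix (Fin 2) (Fin 2) ℝ)
        - (A ((⇑f)^[k] x) : Matrix (Fin 2) (Fin 2) ℝ)) < ε / 2 := by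
    rw [Filter.eventually_all_finset]
    intro k _
    have hcont : Continuous fun x => matOpNorm ((A ((⇑f)^[k] x₀) : Matrix (Fin 2) (Fin 2) ℝ)
        - (A ((⇑f)^[k] x) : Matrix (Fin 2) (Fin 2) ℝ)) :=
      continuous_matOpNorm.comp (continuous_const.sub (hA.comp (f.continuous.iterate k)))
    refine hcont.continuousAt.eventually_lt continuousAt_const ?_
    simp [matOpNorm, hε]
  obtain ⟨U, hU, hUd⟩ := eventually_smallSets.mp hdisj
  obtain ⟨W, hWsub, hWo, hxW⟩ := mem_nhds_iff.mp (inter_mem hU hclose)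
  refine ⟨W, n + 1, ⟨x₀, hxW⟩, hWo, Nat.succ_pos n, fun i j hij hj => ?_,
    fun x hx v w hv hw => ?_⟩
  · exact hUd W (hWsub.trans Set.inter_subset_left) j (Finset.mem_range.mpr hj) i
      (Finset.mem_range.mpr hij)
  · obtain ⟨T, hT, c, hc, hTc⟩ := hx₀ v w hv hw
    refine ⟨fun j => A ((⇑f)^[(j : ℕ)] x₀) * T j, fun j => ?_, c, hc, ?_⟩
    · have h1 : matOpNorm ((A ((⇑f)^[(j : ℕ)] x₀) : Matrix (Fin 2) (Fin 2) ℝ)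
          * ((T j : Matrix (Fin 2) (Fin 2) ℝ) - 1)) ≤ ε / 2 := by
        refine (matOpNorm_mul_le _ _).trans ?_
        have hCj := (hC ((⇑f)^[(j : ℕ)] x₀)).trans ((le_abs_self C).trans (le_add_of_nonneg_right
          zero_le_one))
        refine (mul_le_mul hCj (hT j) (matOpNorm_nonneg _) (by positivity)).trans (le_of_eq ?_)
        field_simp
      have h2 := (hWsub hx).2 j (Finset.mem_range.mpr j.isLt)
      have h3 := matOpNorm_add_le ((A ((⇑f)^[(j : ℕ)] x₀) : Matrix (Fin 2) (Fin 2) ℝ)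
          * ((T j : Matrix (Fin 2) (Fin 2) ℝ) - 1))
        ((A ((⇑f)^[(j : ℕ)] x₀) : Matrix (Fin 2) (Fin 2) ℝ)
          - (A ((⇑f)^[(j : ℕ)] x) : Matrix (Fin 2) (Fin 2) ℝ))
      rw [mul_sub, mul_one, sub_add_sub_cancel] at h3
      rw [Matrix.SpecialLinearGroup.coe_mul]
      rw [mul_sub, mul_one] at h1
      linarith
    · rw [seqProd_eq_ofFn fun k => A ((⇑f)^[k] x₀) * T k]
      exact hTc
end
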